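/- Let S = {(1,0),(−1,0),(−1,1),(1,−1)} (Model 22). Then G_S(t;a,1) ∈ ℚ[a][[t]] and G_S(t;1,b) ∈ ℚ[b][[t]] are D-finite, and there exist D-finite power series F, H ∈ ℚ[a,b][[t]] with H ≠ 0 such that H·G_S(t;a,b) = F. -/

import Mathlib

open PowerSeries

/-- A quarter-plane loop of length `n` with steps in `S`: a sequence of points of
`ℤ≥0 × ℤ≥0` (encoded as `ℕ × ℕ`) starting and ending at the origin, with successive
differences in `S`. -/
def IsQPLoop (S : Set (ℤ × ℤ)) (n : ℕ) (w : Fin (n + 1) → ℕ × ℕ) : Prop :=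
  w 0 = (0, 0) ∧ w (Fin.last n) = (0, 0) ∧
    ∀ i : Fin n, (((w i.succ).1 : ℤ) - ((w i.castSucc).1 : ℤ),
      ((w i.succ).2 : ℤ) - ((w i.castSucc).2 : ℤ)) ∈ S

/-- The number of visits of `w` to the horizontal boundary: indices `1 ≤ i ≤ n`
with the second coordinate of `w i` equal to `0`. -/
def hvisits {n : ℕ} (w : Fin (n + 1) → ℕ × ℕ) : ℕ :=
  (Finset.univ.filter fun i : Fin (n + 1) => 0 < (i : ℕ) ∧ (w i).2 = 0).card

/-- The number of visits of `w` to the vertical boundary: indices `1 ≤ i ≤ n`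
with the first coordinate of `w i` equal to `0`. -/
def vvisits {n : ℕ} (w : Fin (n + 1) → ℕ × ℕ) : ℕ :=
  (Finset.univ.filter fun i : Fin (n + 1) => 0 < (i : ℕ) ∧ (w i).1 = 0).card

/-- The interacting generating function `G_S(t;a,b) = Σ_n t^n Σ_w a^(h(w)) b^(v(w))`,
the inner sum over all quarter-plane loops of length `n` with steps in `S`. -/
noncomputable def loopGF (S : Set (ℤ × ℤ)) {R : Type*} [CommRing R] (a b : R) :
    PowerSeries R :=
  PowerSeries.mk fun n =>
    ∑ᶠ w : {w : Fin (n + 1) → ℕ × ℕ // IsQPLoop S n w}, a ^ hvisits w.1 * b ^ vvisits w.1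

/-- A power series `F ∈ R[[t]]` is D-finite if there are polynomials `p₀, …, p_m`,
not all zero, with `Σ pᵢ · F⁽ⁱ⁾ = 0`, where `F⁽ⁱ⁾` is the `i`-th formal derivative. -/
def IsDFinite {R : Type*} [CommRing R] (F : PowerSeries R) : Prop :=
  ∃ (m : ℕ) (p : Fin (m + 1) → Polynomial R), (∃ i, p i ≠ 0) ∧
    ∑ i : Fin (m + 1), (p i : PowerSeries R) * (PowerSeries.derivativeFun)^[(i : ℕ)] F = 0

section Elimination

variable {R A : Type*} [CommRing R] [CommRing A] [Algebra R A]

/-- The `R`-span of the monomials `t ^ i * x ^ j * y ^ k` with `i, j, k ≤ d`. -/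
def boxSpan (R : Type*) {A : Type*} [CommRing R] [CommRing A] [Algebra R A]
    (t x y : A) (d : ℕ) : Submodule R A :=
  Submodule.span R (Set.range fun e : Fin 3 → Fin (d + 1) =>
    t ^ (e 0 : ℕ) * x ^ (e 1 : ℕ) * y ^ (e 2 : ℕ))

lemma monomial_mem_boxSpan (t x y : A) {d i j k : ℕ} (hi : i ≤ d) (hj : j ≤ d) (hk : k ≤ d) :
    t ^ i * x ^ j * y ^ k ∈ boxSpan R t x y d := by
  refine Submodule.subset_span ⟨![⟨i, by omega⟩, ⟨j, by omega⟩, ⟨k, by omega⟩], ?_⟩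
  simp

@[elab_as_elim]
lemma boxSpan_induction {t x y : A} {d : ℕ} {p : (f : A) → f ∈ boxSpan R t x y d → Prop}
    (zero : p 0 (zero_mem _))
    (add : ∀ f g hf hg, p f hf → p g hg → p (f + g) (add_mem hf hg))
    (smul : ∀ (r : R) f hf, p f hf → p (r • f) (Submodule.smul_mem _ r hf))
    (mon : ∀ i j k (hi : i ≤ d) (hj : j ≤ d) (hk : k ≤ d),
      p (t ^ i * x ^ j * y ^ k) (monomial_mem_boxSpan t x y hi hj hk))
    {f : A} (hf : f ∈ boxSpan R t x y d) : p f hf := by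
  induction hf using Submodule.span_induction with
  | mem f hf =>
    obtain ⟨e, rfl⟩ := hf
    exact mon _ _ _ (by omega) (by omega) (by omega)
  | zero => exact zero
  | add f g _ _ hf hg => exact add f g _ _ hf hg
  | smul r f _ hf => exact smul r f _ hf

lemma boxSpan_mono (t x y : A) {d e : ℕ} (h : d ≤ e) :
    boxSpan R t x y d ≤ boxSpan R t x y e := fun f hf => by
  induction hf using boxSpan_induction with
  | zero => exact zero_mem _
  | add f g _ _ hf hg => exact add_mem hf hg
  | smul r f _ hf => exact Submodule.smul_mem _ r hf
  | mon i j k hi hj hk =>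
    exact monomial_mem_boxSpan t x y (hi.trans h) (hj.trans h) (hk.trans h)

lemma mul_mem_boxSpan {t x y : A} {d e : ℕ} {f g : A} (hf : f ∈ boxSpan R t x y d)
    (hg : g ∈ boxSpan R t x y e) : f * g ∈ boxSpan R t x y (d + e) := by
  induction hf using boxSpan_induction with
  | zero => simp
  | add f₁ f₂ _ _ h₁ h₂ => rw [add_mul]; exact add_mem h₁ h₂
  | smul r f _ h => rw [smul_mul_assoc]; exact Submodule.smul_mem _ r h
  | mon i j k hi hj hk =>
    induction hg using boxSpan_induction with
    | zero => simp
    | add f₁ f₂ _ _ h₁ h₂ => rw [mul_add]; exact add_mem h₁ h₂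
    | smul r f _ h => rw [mul_smul_comm]; exact Submodule.smul_mem _ r h
    | mon i' j' k' hi' hj' hk' =>
      have := monomial_mem_boxSpan (R := R) t x y (add_le_add hi hi') (add_le_add hj hj')
        (add_le_add hk hk')
      convert this using 1
      ring

lemma derivation_mem_boxSpan {t x y : A} (D : Derivation R A A) {a b c : R}
    (ht : D t = algebraMap R A a) (hx : D x = algebraMap R A b) (hy : D y = algebraMap R A c)
    {d : ℕ} {f : A} (hf : f ∈ boxSpan R t x y d) : D f ∈ boxSpan R t x y d := by
  induction hf using boxSpan_induction with
  | zero => simp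
  | add f g _ _ hf hg => rw [map_add]; exact add_mem hf hg
  | smul r f _ hf => rw [D.map_smul]; exact Submodule.smul_mem _ r hf
  | mon i j k hi hj hk =>
    have key : D (t ^ i * x ^ j * y ^ k) =
        ((i : R) * a) • (t ^ (i - 1) * x ^ j * y ^ k) +
        ((j : R) * b) • (t ^ i * x ^ (j - 1) * y ^ k) +
        ((k : R) * c) • (t ^ i * x ^ j * y ^ (k - 1)) := by
      simp only [Derivation.leibniz, Derivation.leibniz_pow, ht, hx, hy, smul_eq_mul,
        Algebra.smul_def, map_mul, map_natCast, eq_natCast]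
      ring
    rw [key]
    refine add_mem (add_mem ?_ ?_) ?_ <;>
      exact Submodule.smul_mem _ _ (monomial_mem_boxSpan _ _ _ (by omega) (by omega) (by omega))

lemma exists_mem_boxSpan {t x y f : A} (hf : f ∈ Algebra.adjoin R {t, x, y}) :
    ∃ d, f ∈ boxSpan R t x y d := by
  induction hf using Algebra.adjoin_induction with
  | mem f hf =>
    refine ⟨1, ?_⟩
    rcases hf with rfl | rfl | rfl
    · simpa using monomial_mem_boxSpan (R := R) f x y le_rfl zero_le_one zero_le_one
    · simpa using monomial_mem_boxSpan (R := R) t f y zero_le_one le_rfl zero_le_one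
    · simpa using monomial_mem_boxSpan (R := R) t x f zero_le_one zero_le_one le_rfl
  | algebraMap r =>
    refine ⟨0, ?_⟩
    rw [Algebra.algebraMap_eq_smul_one]
    refine Submodule.smul_mem _ r ?_
    simpa using monomial_mem_boxSpan (R := R) t x y (Nat.zero_le 0) (Nat.zero_le 0) (Nat.zero_le 0)
  | add f g _ _ hf hg =>
    obtain ⟨d, hd⟩ := hf
    obtain ⟨e, he⟩ := hg
    exact ⟨max d e, add_mem (boxSpan_mono t x y (le_max_left d e) hd)
      (boxSpan_mono t x y (le_max_right d e) he)⟩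
  | mul f g _ _ hf hg =>
    obtain ⟨d, hd⟩ := hf
    obtain ⟨e, he⟩ := hg
    exact ⟨d + e, mul_mem_boxSpan hd he⟩

variable {t x y Q : A} {q : ℕ}

lemma pow_mul_derivation_mem_boxSpan {D : Derivation R A A}
    (hD : ∀ d f, f ∈ boxSpan R t x y d → D f ∈ boxSpan R t x y d)
    (hQ : Q ∈ boxSpan R t x y q) {m d : ℕ} {g : A} (hg : Q ^ m * g ∈ boxSpan R t x y d) :
    Q ^ (m + 1) * D g ∈ boxSpan R t x y (d + q) := by
  have key : Q ^ (m + 1) * D g = D (Q ^ m * g) * Q - (m : R) • (Q ^ m * g * D Q) := by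
    rcases m with _ | m
    · simp [mul_comm]
    · simp only [Derivation.leibniz, Derivation.leibniz_pow, smul_eq_mul, nsmul_eq_mul,
        Nat.add_sub_cancel, Nat.cast_smul_eq_nsmul]
      ring
  rw [key]
  exact sub_mem (mul_mem_boxSpan (hD _ _ hg) hQ)
    (Submodule.smul_mem _ _ (mul_mem_boxSpan hg (hD _ _ hQ)))

lemma pow_mul_iterate_derivation_mem_boxSpan {D : Derivation R A A}
    (hD : ∀ d f, f ∈ boxSpan R t x y d → D f ∈ boxSpan R t x y d)
    (hQ : Q ∈ boxSpan R t x y q) {m d : ℕ} {g : A} (hg : Q ^ m * g ∈ boxSpan R t x y d) (n : ℕ) :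
    Q ^ (m + n) * D^[n] g ∈ boxSpan R t x y (d + n * q) := by
  induction n with
  | zero => simpa using hg
  | succ n ih =>
    rw [Function.iterate_succ_apply']
    have h := pow_mul_derivation_mem_boxSpan hD hQ ih
    rw [show d + n * q + q = d + (n + 1) * q by ring] at h
    exact h

/-- Dimension counting: the operators `t ^ i * Dt ^ j * Dx ^ k * Dy ^ l` applied to a rational
function of `t, x, y` are linearly dependent over the base ring. -/
theorem exists_annihilating_operator [Nontrivial R] {Dt Dx Dy : Derivation R A A}
    (hDt : ∀ d f, f ∈ boxSpan R t x y d → Dt f ∈ boxSpan R t x y d)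
    (hDx : ∀ d f, f ∈ boxSpan R t x y d → Dx f ∈ boxSpan R t x y d)
    (hDy : ∀ d f, f ∈ boxSpan R t x y d → Dy f ∈ boxSpan R t x y d)
    {f : A} (hu : IsUnit Q) (hQ : Q ∈ Algebra.adjoin R {t, x, y})
    (hf : Q * f ∈ Algebra.adjoin R {t, x, y}) :
    ∃ (n : ℕ) (c : (Fin 4 → Fin (n + 1)) → R), c ≠ 0 ∧
      ∑ e, c e • (t ^ (e 0 : ℕ) * Dt^[e 1] (Dx^[e 2] (Dy^[e 3] f))) = 0 := by
  obtain ⟨q, hq⟩ := exists_mem_boxSpan hQ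
  obtain ⟨d, hd⟩ := exists_mem_boxSpan hf
  set b := d + 3 * q + 2 with hb
  set n := b ^ 3 with hn
  set M := 1 + 3 * n with hM
  set N := d + 3 * n * q + n with hN
  have hmem (e : Fin 4 → Fin (n + 1)) :
      Q ^ M * (t ^ (e 0 : ℕ) * Dt^[e 1] (Dx^[e 2] (Dy^[e 3] f))) ∈ boxSpan R t x y N := by
    have h₁ : Q ^ 1 * f ∈ boxSpan R t x y d := by simpa using hd
    have h₂ := pow_mul_iterate_derivation_mem_boxSpan hDt hq
      (pow_mul_iterate_derivation_mem_boxSpan hDx hq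
        (pow_mul_iterate_derivation_mem_boxSpan hDy hq h₁ (e 3)) (e 2)) (e 1)
    obtain ⟨r, hr⟩ : ∃ r, (e 1 : ℕ) + e 2 + e 3 + r = 3 * n :=
      ⟨3 * n - (e 1 + e 2 + e 3), by omega⟩
    have h₃ : Q ^ r ∈ boxSpan R t x y (r * q) := by
      clear hr
      induction r with
      | zero =>
        simpa using monomial_mem_boxSpan (R := R) t x y (Nat.zero_le 0) (Nat.zero_le 0)
          (Nat.zero_le 0)
      | succ r ih => rw [pow_succ, add_mul, one_mul]; exact mul_mem_boxSpan ih hq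
    have h₄ : t ^ (e 0 : ℕ) ∈ boxSpan R t x y n := by
      simpa using monomial_mem_boxSpan (R := R) t x y (by omega : (e 0 : ℕ) ≤ n)
        (Nat.zero_le n) (Nat.zero_le n)
    convert mul_mem_boxSpan (mul_mem_boxSpan h₂ h₃) h₄ using 1
    · rw [hN, ← hr]; ring_nf
    · rw [show M = 1 + e 3 + e 2 + e 1 + r by omega]; ring
  choose m hm using fun e => Submodule.mem_span_range_iff_exists_fun R |>.1 (hmem e)
  let L : ((Fin 4 → Fin (n + 1)) → R) →ₗ[R] ((Fin 3 → Fin (N + 1)) → R) :=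
    Fintype.linearCombination R m
  have hL : ¬ Function.Injective L := fun h => by
    have := card_le_of_injective R L h
    simp only [Fintype.card_pi, Fintype.card_fin, Finset.prod_const, Finset.card_univ] at this
    have h₁ : N + 1 ≤ b * (n + 1) := by
      rw [hN, hb]; nlinarith [Nat.zero_le (d * n), Nat.zero_le q]
    have h₂ : (N + 1) ^ 3 ≤ n * (n + 1) ^ 3 := by
      calc (N + 1) ^ 3 ≤ (b * (n + 1)) ^ 3 := Nat.pow_le_pow_left h₁ 3
        _ = n * (n + 1) ^ 3 := by rw [mul_pow, ← hn]
    have h₃ : 0 < (n + 1) ^ 3 := by positivity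
    nlinarith
  obtain ⟨c, hc, hc0⟩ : ∃ c, L c = 0 ∧ c ≠ 0 := by
    by_contra! h
    exact hL ((injective_iff_map_eq_zero L).2 h)
  refine ⟨n, c, hc0, ?_⟩
  rw [← (hu.pow M).mul_right_eq_zero, Finset.mul_sum]
  simp_rw [mul_smul_comm, ← hm, Finset.smul_sum]
  rw [Finset.sum_comm]
  refine Finset.sum_eq_zero fun e' _ => ?_
  simp_rw [← mul_smul, ← smul_eq_mul (a := c _), ← Finset.sum_smul]
  have := congr_fun hc e'
  simp only [L, Fintype.linearCombination_apply, Finset.sum_apply, Pi.smul_apply,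
    Pi.zero_apply] at this
  rw [this, zero_smul]

end Elimination

section Coefficientwise

variable {R C C' : Type*} [CommRing R] [CommRing C] [CommRing C'] [Algebra R C] [Algebra R C']

/-- Apply a linear map to every coefficient of a power series. -/
noncomputable def coeffwise (φ : C →ₗ[R] C') : C⟦X⟧ →ₗ[R] C'⟦X⟧ where
  toFun f := mk fun n => φ (coeff n f)
  map_add' f g := by ext; simp
  map_smul' r f := by ext; simp

@[simp]
lemma coeff_coeffwise (φ : C →ₗ[R] C') (f : C⟦X⟧) (n : ℕ) :
    coeff n (coeffwise φ f) = φ (coeff n f) := by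
  simp [coeffwise]

lemma coeffwise_X_pow_mul (φ : C →ₗ[R] C') (f : C⟦X⟧) (n : ℕ) :
    coeffwise φ (X ^ n * f) = X ^ n * coeffwise φ f := by
  ext m
  simp only [coeff_coeffwise, coeff_X_pow_mul']
  split_ifs <;> simp

lemma coeffwise_iterate_derivative (φ : C →ₗ[R] C') (f : C⟦X⟧) (n : ℕ) :
    coeffwise φ ((derivative C)^[n] f) = (derivative C')^[n] (coeffwise φ f) := by
  induction n with
  | zero => rfl
  | succ n ih =>
    rw [Function.iterate_succ_apply', Function.iterate_succ_apply', ← ih]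
    ext m
    simp only [coeff_coeffwise, coeff_derivative]
    have h (c : C) : φ (c * (m + 1)) = φ c * (m + 1) := by
      have := φ.map_smul_of_tower (m + 1) c
      simpa [nsmul_eq_mul, mul_comm] using this
    exact h _

/-- Apply a derivation to every coefficient of a power series. -/
noncomputable def coeffwiseDerivation (D : Derivation R C C) : Derivation R C⟦X⟧ C⟦X⟧ :=
  Derivation.mk' (coeffwise D) fun f g => by
    ext n
    simp only [coeff_coeffwise, smul_eq_mul, map_add, coeff_mul, map_sum, Derivation.coeFn_coe,
      Derivation.leibniz, Finset.sum_add_distrib]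
    congr 1
    exact (Finset.Nat.sum_antidiagonal_swap (f := fun p => coeff p.1 g * D (coeff p.2 f)))

lemma coeff_coeffwiseDerivation (D : Derivation R C C) (f : C⟦X⟧) (n : ℕ) :
    coeff n (coeffwiseDerivation D f) = D (coeff n f) :=
  coeff_coeffwise D.toLinearMap f n

lemma coeffwiseDerivation_C (D : Derivation R C C) (c : C) :
    coeffwiseDerivation D (PowerSeries.C c) = PowerSeries.C (D c) := by
  ext n
  rw [coeff_coeffwiseDerivation, coeff_C, coeff_C]
  split_ifs <;> simp

lemma coeffwiseDerivation_X (D : Derivation R C C) : coeffwiseDerivation D X = 0 := by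
  ext n
  rw [coeff_coeffwiseDerivation, coeff_X]
  split_ifs <;> simp

end Coefficientwise

section Residue

variable {R C C' : Type*} [CommRing R] [CommRing C] [CommRing C'] [Algebra R C] [Algebra R C']

lemma coeffwise_iterate_derivation {D : Derivation R C C} {res : ℤ → C →ₗ[R] C'}
    (h : ∀ i f, res i (D f) = (i + 1) • res (i + 1) f) (i : ℤ) (n : ℕ) (f : C⟦X⟧) :
    coeffwise (res i) ((coeffwiseDerivation D)^[n] f) =
      (∏ r ∈ Finset.range n, (i + 1 + r)) • coeffwise (res (i + n)) f := by
  induction n generalizing i with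
  | zero => simp
  | succ n ih =>
    have h₁ : coeffwise (res i) (coeffwiseDerivation D ((coeffwiseDerivation D)^[n] f)) =
        (i + 1) • coeffwise (res (i + 1)) ((coeffwiseDerivation D)^[n] f) := by
      ext m
      rw [coeff_coeffwise, coeff_coeffwiseDerivation, h, map_zsmul, coeff_coeffwise]
    rw [Function.iterate_succ_apply', h₁, ih, smul_smul, Finset.prod_range_succ']
    congr 1
    · rw [mul_comm]
      push_cast
      congr 1
      · exact Finset.prod_congr rfl fun r _ => by ring
      · ring
    · rw [show i + 1 + (n : ℤ) = i + ((n + 1 : ℕ) : ℤ) by push_cast; ring]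

lemma prod_range_neg_add_eq_zero {k n : ℕ} (h : k < n) :
    ∏ r ∈ Finset.range n, (-1 - (k : ℤ) + 1 + r) = 0 :=
  Finset.prod_eq_zero (Finset.mem_range.2 h) (by ring)

lemma prod_range_neg_add_ne_zero (k : ℕ) :
    ∏ r ∈ Finset.range k, (-1 - (k : ℤ) + 1 + r) ≠ 0 :=
  Finset.prod_ne_zero_iff.2 fun r hr => by
    have := Finset.mem_range.1 hr
    omega

/-- A series is rational with respect to `x`, `y` if it becomes a polynomial in `X`, `x`, `y` after
multiplication by a unit which is itself such a polynomial. -/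
def IsRationalSeries (R : Type*) {C : Type*} [CommRing R] [CommRing C] [Algebra R C] (x y : C)
    (f : C⟦X⟧) : Prop :=
  ∃ Q ∈ Algebra.adjoin R {(X : C⟦X⟧), PowerSeries.C x, PowerSeries.C y}, IsUnit Q ∧
    Q * f ∈ Algebra.adjoin R {(X : C⟦X⟧), PowerSeries.C x, PowerSeries.C y}

/-- The residue of a rational series satisfies a linear differential equation with polynomial
coefficients. -/
theorem exists_ode_residue [IsDomain R] [CharZero R] {Dx Dy : Derivation R C C} {x y : C}
    (hxx : Dx x = 1) (hxy : Dx y = 0) (hyx : Dy x = 0) (hyy : Dy y = 1)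
    {res : ℤ → ℤ → C →ₗ[R] C'} (hx : ∀ i j f, res i j (Dx f) = (i + 1) • res (i + 1) j f)
    (hy : ∀ i j f, res i j (Dy f) = (j + 1) • res i (j + 1) f)
    {f : C⟦X⟧} (hf : IsRationalSeries R x y f) :
    ∃ (m : ℕ) (p : Fin (m + 1) → Polynomial R), (∃ i, p i ≠ 0) ∧
      ∑ i : Fin (m + 1), ((p i).map (algebraMap R C') : C'⟦X⟧) *
        (derivative C')^[i] (coeffwise (res (-1) (-1)) f) = 0 := by
  classical
  obtain ⟨Q, hQ, hu, hQf⟩ := hf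
  let Dt : Derivation R C⟦X⟧ C⟦X⟧ := (derivative C).restrictScalars R
  obtain ⟨n, c, hc, hsum⟩ := exists_annihilating_operator (Dt := Dt)
    (Dx := coeffwiseDerivation Dx) (Dy := coeffwiseDerivation Dy)
    (fun d f => derivation_mem_boxSpan _ (a := 1) (b := 0) (c := 0)
      (by simp [Dt]) (by simp [Dt]) (by simp [Dt]))
    (fun d f => derivation_mem_boxSpan _ (a := 0) (b := 1) (c := 0)
      (by simp [coeffwiseDerivation_X]) (by simp [coeffwiseDerivation_C, hxx])
      (by simp [coeffwiseDerivation_C, hxy]))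
    (fun d f => derivation_mem_boxSpan _ (a := 0) (b := 0) (c := 1)
      (by simp [coeffwiseDerivation_X]) (by simp [coeffwiseDerivation_C, hyx])
      (by simp [coeffwiseDerivation_C, hyy])) hu hQ hQf
  obtain ⟨s, hs, hsmin⟩ : ∃ s, c s ≠ 0 ∧ ∀ e, c e ≠ 0 →
      toLex ((s 2 : ℕ), (s 3 : ℕ)) ≤ toLex ((e 2 : ℕ), (e 3 : ℕ)) := by
    have hne : (Finset.univ.filter fun e => c e ≠ 0).Nonempty := by
      obtain ⟨e, he⟩ := Function.ne_iff.1 hc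
      exact ⟨e, by simpa using he⟩
    obtain ⟨s, hs, hmin⟩ := Finset.exists_min_image _
      (fun e : Fin 4 → Fin (n + 1) => toLex ((e 2 : ℕ), (e 3 : ℕ))) hne
    exact ⟨s, by simpa using hs, fun e he => hmin e (by simpa using he)⟩
  set k : ℕ := (s 2 : ℕ)
  set l : ℕ := (s 3 : ℕ)
  set K : ℤ := (∏ r ∈ Finset.range k, (-1 - (k : ℤ) + 1 + r)) *
    ∏ r ∈ Finset.range l, (-1 - (l : ℤ) + 1 + r) with hK
  have hK0 : K ≠ 0 := mul_ne_zero (prod_range_neg_add_ne_zero k) (prod_range_neg_add_ne_zero l)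
  set g := coeffwise (res (-1) (-1)) f with hg
  have hterm (e : Fin 4 → Fin (n + 1)) :
      coeffwise (res (-1 - k) (-1 - l)) (c e • (X ^ (e 0 : ℕ) * Dt^[e 1]
        ((coeffwiseDerivation Dx)^[e 2] ((coeffwiseDerivation Dy)^[e 3] f)))) =
      if (e 2 : ℕ) = k ∧ (e 3 : ℕ) = l then
        (K * c e : R) • (X ^ (e 0 : ℕ) * (derivative C')^[e 1] g) else 0 := by
    have h₁ : ∀ h : C⟦X⟧, Dt^[e 1] h = (derivative C)^[e 1] h := fun _ => rfl
    rw [map_smul, coeffwise_X_pow_mul, h₁, coeffwise_iterate_derivative,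
      coeffwise_iterate_derivation (res := fun i => res i (-1 - l)) (fun i f => hx i _ f)]
    rw [coeffwise_iterate_derivation (fun i f => hy _ i f)]
    by_cases hce : c e = 0
    · simp [hce]
    split_ifs with h
    · rw [h.1, h.2]
      simp only [sub_add_cancel, ← hg]
      have h₂ (z : ℤ) (u : C'⟦X⟧) :
          (derivative C')^[e 1] (z • u) = z • (derivative C')^[e 1] u := by
        induction (e 1 : ℕ) with
        | zero => rfl
        | succ m ih =>
          rw [Function.iterate_succ_apply', ih, map_zsmul, Function.iterate_succ_apply']
      rw [h₂, h₂, mul_smul_comm, mul_smul_comm, mul_smul, Int.cast_smul_eq_zsmul, hK, mul_smul,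
        smul_comm (c e), smul_comm (c e)]
    · have h₃ : (∏ r ∈ Finset.range (e 2 : ℕ), (-1 - (k : ℤ) + 1 + r)) = 0 ∨
          (∏ r ∈ Finset.range (e 3 : ℕ), (-1 - (l : ℤ) + 1 + r)) = 0 := by
        rcases Prod.Lex.toLex_le_toLex.1 (hsmin e hce) with h' | ⟨h', h''⟩
        · exact Or.inl (prod_range_neg_add_eq_zero h')
        · refine Or.inr (prod_range_neg_add_eq_zero (lt_of_le_of_ne h''
            fun h₄ => h ⟨h'.symm, h₄.symm⟩))
      have h₅ : (derivative C')^[e 1] 0 = 0 := by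
        induction (e 1 : ℕ) with
        | zero => rfl
        | succ m ih => rw [Function.iterate_succ_apply', ih, map_zero]
      rcases h₃ with h₃ | h₃ <;> simp [h₃, h₅]
  refine ⟨n, fun j => ∑ e : Fin 4 → Fin (n + 1), if (e 2 : ℕ) = k ∧ (e 3 : ℕ) = l ∧ e 1 = j then
    Polynomial.monomial (e 0 : ℕ) (K * c e : R) else 0, ⟨s 1, fun h => ?_⟩, ?_⟩
  · have h₁ := congr_arg (fun p => Polynomial.coeff p (s 0)) h
    simp only [Polynomial.finsetSum_coeff, Polynomial.coeff_zero] at h₁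
    rw [Finset.sum_eq_single s] at h₁
    · simp only [k, l, and_self, if_true, Polynomial.coeff_monomial, mul_eq_zero] at h₁
      rcases h₁ with h₁ | h₁
      · exact hK0 (by exact_mod_cast h₁)
      · exact hs h₁
    · intro e _ he
      split_ifs with h₂
      · rw [Polynomial.coeff_monomial, if_neg]
        intro h₃
        apply he
        funext i
        fin_cases i
        · exact Fin.ext h₃
        · exact h₂.2.2
        · exact Fin.ext h₂.1
        · exact Fin.ext h₂.2.1
      · simp
    · simp
  · have h₁ := congr_arg (coeffwise (res (-1 - k) (-1 - l))) hsum
    rw [map_sum, map_zero, Finset.sum_congr rfl fun e _ => hterm e] at h₁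
    rw [← h₁]
    simp only [Polynomial.map_sum]
    have h₂ (j : Fin (n + 1)) : ((∑ e : Fin 4 → Fin (n + 1), (if (e 2 : ℕ) = k ∧ (e 3 : ℕ) = l ∧
        e 1 = j then Polynomial.monomial (e 0 : ℕ) (K * c e : R) else 0).map (algebraMap R C') :
          Polynomial C') : C'⟦X⟧) * (derivative C')^[j] g =
        ∑ e : Fin 4 → Fin (n + 1), if e 1 = j then if (e 2 : ℕ) = k ∧ (e 3 : ℕ) = l then
        (K * c e : R) • (X ^ (e 0 : ℕ) * (derivative C')^[e 1] g) else 0 else 0 := by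
      rw [← Polynomial.coeToPowerSeries.ringHom_apply, map_sum, Finset.sum_mul]
      refine Finset.sum_congr rfl fun e _ => ?_
      by_cases h₃ : e 1 = j
      · subst h₃
        by_cases h₄ : (e 2 : ℕ) = k ∧ (e 3 : ℕ) = l
        · rw [if_pos ⟨h₄.1, h₄.2, rfl⟩, if_pos rfl, if_pos h₄, Polynomial.map_monomial,
            Polynomial.coeToPowerSeries.ringHom_apply, Polynomial.coe_monomial,
            ← smul_mul_assoc]
          congr 1
          ext m
          rw [coeff_monomial, coeff_smul, coeff_X_pow, Algebra.smul_def]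
          simp
        · rw [if_neg fun h => h₄ ⟨h.1, h.2.1⟩, if_pos rfl, if_neg h₄]
          simp
      · rw [if_neg fun h => h₃ h.2.2, if_neg h₃]
        simp
    rw [Finset.sum_congr rfl fun j _ => h₂ j, Finset.sum_comm]
    simp

end Residue

section BiLaurent

variable {k : Type*} [CommRing k]

/-- Power series in `X` whose coefficients are Laurent polynomials in two variables. -/
abbrev BiLaurent (k : Type*) [CommRing k] : Type _ := (AddMonoidAlgebra k (ℤ × ℤ))⟦X⟧

/-- The Laurent monomial with exponents `(i, j)`. -/
noncomputable def mon (k : Type*) [CommRing k] (i j : ℤ) : BiLaurent k :=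
  PowerSeries.C (AddMonoidAlgebra.single (i, j) 1)

lemma mon_mul_mon (i j i' j' : ℤ) : mon k i j * mon k i' j' = mon k (i + i') (j + j') := by
  simp [mon, ← map_mul, AddMonoidAlgebra.single_mul_single]

lemma mon_zero : mon k 0 0 = 1 := by
  rw [mon, show ((0 : ℤ), (0 : ℤ)) = 0 from rfl, ← AddMonoidAlgebra.one_def, map_one]

/-- The coefficient of a Laurent monomial. -/
noncomputable def monCoeff (v : ℤ × ℤ) : BiLaurent k →ₗ[k⟦X⟧] k⟦X⟧ where
  toFun F := mk fun n => (coeff n F).coeff v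
  map_add' F G := by ext; simp
  map_smul' r F := by
    ext n
    simp [Algebra.smul_def, algebraMap_apply'', coeff_mul]

lemma coeff_monCoeff (v : ℤ × ℤ) (F : BiLaurent k) (n : ℕ) :
    coeff n (monCoeff v F) = (coeff n F).coeff v := by
  simp [monCoeff]

lemma monCoeff_mon_mul (i j : ℤ) (v : ℤ × ℤ) (F : BiLaurent k) :
    monCoeff v (mon k i j * F) = monCoeff (v.1 - i, v.2 - j) F := by
  ext n
  rw [coeff_monCoeff, coeff_monCoeff, mon, coeff_C_mul, AddMonoidAlgebra.coeff_single_mul_apply,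
    one_mul]
  congr 1
  ext <;> simp [sub_eq_neg_add]

lemma monCoeff_one : monCoeff (0, 0) (1 : BiLaurent k) = 1 := by
  ext n
  rw [coeff_monCoeff, coeff_one, coeff_one]
  split_ifs
  · exact AddMonoidAlgebra.coeff_one_zero
  · simp

/-- The substitution of Laurent monomials induced by an automorphism of the exponents. -/
noncomputable def monSubst (e : (ℤ × ℤ) ≃+ (ℤ × ℤ)) : BiLaurent k →+* BiLaurent k :=
  PowerSeries.map (AddMonoidAlgebra.domCongr k k e).toAlgHom.toRingHom

lemma monSubst_mon (e : (ℤ × ℤ) ≃+ (ℤ × ℤ)) (i j : ℤ) :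
    monSubst e (mon k i j) = mon k (e (i, j)).1 (e (i, j)).2 := by
  simp [monSubst, mon, map_C]

lemma monSubst_algebraMap (e : (ℤ × ℤ) ≃+ (ℤ × ℤ)) (r : k⟦X⟧) :
    monSubst e (algebraMap k⟦X⟧ (BiLaurent k) r) = algebraMap k⟦X⟧ (BiLaurent k) r := by
  ext1 n
  simp [monSubst, algebraMap_apply'']

lemma monCoeff_monSubst (e : (ℤ × ℤ) ≃+ (ℤ × ℤ)) (v : ℤ × ℤ) (F : BiLaurent k) :
    monCoeff v (monSubst e F) = monCoeff (e.symm v) F := by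
  ext n
  rw [coeff_monCoeff, coeff_monCoeff, monSubst, coeff_map]
  exact AddMonoidAlgebra.coeff_domCongr ..

lemma monCoeff_eq_zero_of_antisymm [IsDomain k] [CharZero k] {e : (ℤ × ℤ) ≃+ (ℤ × ℤ)} {v : ℤ × ℤ}
    {F : BiLaurent k} (hv : e v = v) (hF : monSubst e F = -F) : monCoeff v F = 0 := by
  have h := monCoeff_monSubst e v F
  rw [hF, map_neg, e.symm_apply_eq.2 hv.symm] at h
  ext n
  exact self_eq_neg.1 (by simpa using congr_arg (coeff n) h.symm)

/-- The derivation multiplying the monomial of exponents `v` by `l v`. -/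
noncomputable def weightDerivation (l : ℤ × ℤ →+ ℤ) :
    Derivation k (AddMonoidAlgebra k (ℤ × ℤ)) (AddMonoidAlgebra k (ℤ × ℤ)) :=
  Derivation.mk'
    ((AddMonoidAlgebra.coeffLinearEquiv k).symm.toLinearMap ∘ₗ
      Finsupp.lsum k (fun v => (l v : k) • Finsupp.lsingle v) ∘ₗ
      (AddMonoidAlgebra.coeffLinearEquiv k).toLinearMap) fun f g => by
    induction f using AddMonoidAlgebra.induction_linear with
    | zero => simp
    | add f₁ f₂ h₁ h₂ =>
      simp only [add_mul, map_add, h₁, h₂, smul_eq_mul, mul_add]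
      ring
    | single v c =>
      induction g using AddMonoidAlgebra.induction_linear with
      | zero => simp
      | add f₁ f₂ h₁ h₂ =>
        simp only [mul_add, map_add, h₁, h₂, smul_eq_mul, add_mul]
        ring
      | single w d =>
        simp only [LinearMap.comp_apply, LinearEquiv.coe_coe, AddMonoidAlgebra.single_mul_single,
          AddMonoidAlgebra.coeffLinearEquiv_apply, AddMonoidAlgebra.coeff_single,
          Finsupp.lsum_single, LinearMap.smul_apply, Finsupp.lsingle_apply, Finsupp.smul_single,
          AddMonoidAlgebra.coeffLinearEquiv_symm_apply, AddMonoidAlgebra.ofCoeff_single,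
          smul_eq_mul, map_add, Int.cast_add]
        rw [add_comm w v, ← AddMonoidAlgebra.single_add]
        congr 1
        ring

lemma weightDerivation_single (l : ℤ × ℤ →+ ℤ) (v : ℤ × ℤ) (c : k) :
    weightDerivation l (AddMonoidAlgebra.single v c) = AddMonoidAlgebra.single v (l v * c) := by
  change (AddMonoidAlgebra.coeffLinearEquiv k).symm (Finsupp.lsum k _ (Finsupp.single v c)) = _
  rw [Finsupp.lsum_single]
  simp only [LinearMap.smul_apply, Finsupp.lsingle_apply, Finsupp.smul_single, smul_eq_mul,
    AddMonoidAlgebra.coeffLinearEquiv_symm_apply, AddMonoidAlgebra.ofCoeff_single]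

lemma coeff_weightDerivation (l : ℤ × ℤ →+ ℤ) (v : ℤ × ℤ) (f : AddMonoidAlgebra k (ℤ × ℤ)) :
    (weightDerivation l f).coeff v = l v * f.coeff v := by
  induction f using AddMonoidAlgebra.induction_linear with
  | zero => simp
  | add f g hf hg => simp [hf, hg, mul_add]
  | single w c =>
    rw [weightDerivation_single, AddMonoidAlgebra.coeff_single, AddMonoidAlgebra.coeff_single]
    by_cases h : w = v <;> simp [h]

/-- The derivation `F ↦ x ^ i * y ^ j * l F`, where `l F` multiplies the monomial of exponents `v`
by `l v`. -/
noncomputable def monDerivation (l : ℤ × ℤ →+ ℤ) (i j : ℤ) :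
    Derivation k⟦X⟧ (BiLaurent k) (BiLaurent k) :=
  mon k i j • Derivation.mk'
    { toFun := coeffwiseDerivation (weightDerivation l)
      map_add' := map_add _
      map_smul' := fun r F => by
        have h : coeffwiseDerivation (weightDerivation l)
            (algebraMap k⟦X⟧ (BiLaurent k) r) = 0 := by
          ext1 n
          simp [coeff_coeffwiseDerivation, algebraMap_apply'', weightDerivation_single]
        simp [Algebra.smul_def, h] } fun f g => by simp

lemma monDerivation_mon (l : ℤ × ℤ →+ ℤ) (i j i' j' : ℤ) :
    monDerivation l i j (mon k i' j') = (l (i', j') : k⟦X⟧) • mon k (i + i') (j + j') := by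
  have h : coeffwiseDerivation (weightDerivation l) (mon k i' j') =
      (l (i', j') : k⟦X⟧) • mon k i' j' := by
    rw [mon, coeffwiseDerivation_C, weightDerivation_single, Int.cast_smul_eq_zsmul, ← map_zsmul]
    congr 1
    ext
    simp [AddMonoidAlgebra.coeff_single]
  change mon k i j * coeffwiseDerivation (weightDerivation l) (mon k i' j') = _
  rw [h, mul_smul_comm, mon_mul_mon]

lemma monCoeff_monDerivation (l : ℤ × ℤ →+ ℤ) (i j : ℤ) (v : ℤ × ℤ) (F : BiLaurent k) :
    monCoeff v (monDerivation l i j F) =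
      l (v.1 - i, v.2 - j) • monCoeff (v.1 - i, v.2 - j) F := by
  change monCoeff v (mon k i j * coeffwiseDerivation (weightDerivation l) F) = _
  rw [monCoeff_mon_mul]
  ext n
  rw [coeff_monCoeff, coeff_coeffwiseDerivation, coeff_weightDerivation, map_zsmul, coeff_monCoeff,
    zsmul_eq_mul]

end BiLaurent

section Ansatz

variable {k : Type*} [CommRing k]

/-- The generating function of the steps. -/
noncomputable def stepSum (k : Type*) [CommRing k] : BiLaurent k :=
  mon k 1 0 + mon k (-1) 0 + mon k (-1) 1 + mon k 1 (-1)

/-- The first denominator of the Bethe ansatz. -/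
noncomputable def den₁ (α : k⟦X⟧) : BiLaurent k :=
  1 - algebraMap k⟦X⟧ _ α * (mon k (-2) 0 + mon k (-2) 1 + mon k 0 (-1))

/-- The second denominator of the Bethe ansatz. -/
noncomputable def den₂ (α : k⟦X⟧) : BiLaurent k :=
  1 - algebraMap k⟦X⟧ _ α * (mon k 2 (-2) + mon k 2 (-1) + mon k 0 (-1))

/-- The third denominator of the Bethe ansatz. -/
noncomputable def den₃ (β : k⟦X⟧) : BiLaurent k :=
  1 - algebraMap k⟦X⟧ _ β * mon k 0 (-1)

/-- The fourth denominator of the Bethe ansatz. -/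
noncomputable def den₄ (β : k⟦X⟧) : BiLaurent k :=
  1 - algebraMap k⟦X⟧ _ β * mon k (-2) 1

/-- The numerator of the Bethe ansatz. -/
noncomputable def ansatzNum (k : Type*) [CommRing k] : BiLaurent k :=
  (1 - mon k (-2) 0) * (1 - mon k 2 (-2)) * (1 - mon k 0 (-1)) * (1 - mon k (-2) 1)

lemma isUnit_one_sub_algebraMap_mul {α : k⟦X⟧} (hα : constantCoeff α = 0) (F : BiLaurent k) :
    IsUnit (1 - algebraMap k⟦X⟧ (BiLaurent k) α * F) := by
  rw [isUnit_iff_constantCoeff]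
  have h : constantCoeff (algebraMap k⟦X⟧ (BiLaurent k) α) = 0 := by
    rw [algebraMap_apply'', ← coeff_zero_eq_constantCoeff_apply, coeff_map,
      coeff_zero_eq_constantCoeff_apply, hα, map_zero]
  simp [h]

/-- The automorphism of exponents fixing the horizontal axis. -/
def reflY : (ℤ × ℤ) ≃+ (ℤ × ℤ) where
  toFun v := (v.1 + 2 * v.2, -v.2)
  invFun v := (v.1 + 2 * v.2, -v.2)
  left_inv v := by ext <;> simp
  right_inv v := by ext <;> simp
  map_add' v w := by ext <;> simp <;> ring

/-- The automorphism of exponents fixing the vertical axis. -/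
def reflX : (ℤ × ℤ) ≃+ (ℤ × ℤ) where
  toFun v := (-v.1, v.1 + v.2)
  invFun v := (-v.1, v.1 + v.2)
  left_inv v := by ext <;> simp
  right_inv v := by ext <;> simp
  map_add' v w := by ext <;> simp <;> ring

lemma reflY_apply (v : ℤ × ℤ) : reflY v = (v.1 + 2 * v.2, -v.2) := rfl

lemma reflX_apply (v : ℤ × ℤ) : reflX v = (-v.1, v.1 + v.2) := rfl

lemma antisymm_of_mul {A : Type*} [CommRing A] {σ : A →+* A} {h U N : A} (hu : IsUnit h)
    (hh : σ h = h) (hN : σ N = -N) (hU : h * U = N) : σ U = -U := by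
  have := congr_arg σ hU
  rw [map_mul, hh, hN, ← hU] at this
  exact hu.mul_left_cancel (by rw [this, mul_neg])

lemma monCoeff_stepSum_mul (v : ℤ × ℤ) (F : BiLaurent k) :
    monCoeff v (stepSum k * F) = monCoeff (v.1 + 1, v.2) F + monCoeff (v.1 - 1, v.2) F +
      monCoeff (v.1 - 1, v.2 + 1) F + monCoeff (v.1 + 1, v.2 - 1) F := by
  simp only [stepSum, add_mul, map_add, monCoeff_mon_mul, sub_neg_eq_add, sub_zero]
  ring

variable [IsDomain k] [CharZero k] {α β : k⟦X⟧} {Ω : BiLaurent k}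

/-- The boundary relation on the horizontal axis. -/
lemma monCoeff_horizontal (hα : constantCoeff α = 0) (hβ : constantCoeff β = 0)
    (hΩ : den₁ α * den₂ α * den₃ β * den₄ β * Ω = ansatzNum k) (n : ℕ) (i : ℤ) :
    monCoeff (i + 1, -1) (stepSum k ^ n * Ω) = α * (monCoeff (i + 1, 0) (stepSum k ^ n * Ω) +
      monCoeff (i - 1, 0) (stepSum k ^ n * Ω) + monCoeff (i - 1, 1) (stepSum k ^ n * Ω)) := by
  have hu : IsUnit (den₁ α * den₃ β * den₄ β) :=
    ((isUnit_one_sub_algebraMap_mul hα _).mul (isUnit_one_sub_algebraMap_mul hβ _)).mul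
      (isUnit_one_sub_algebraMap_mul hβ _)
  have hS : monSubst reflY (stepSum k) = stepSum k := by
    simp only [stepSum, map_add, monSubst_mon, reflY_apply]
    norm_num
    ring
  have h := antisymm_of_mul (σ := monSubst reflY) (U := mon k (-1) 1 * den₂ α * (stepSum k ^ n * Ω))
    (N := mon k (-1) 1 * ansatzNum k * stepSum k ^ n) hu
    (by
      simp only [den₁, den₃, den₄, map_add, map_sub, map_mul, map_one, monSubst_mon,
        monSubst_algebraMap, reflY_apply]
      norm_num
      ring)
    (by
      rw [map_mul, map_pow, hS]
      simp only [ansatzNum, map_sub, map_mul, map_one, monSubst_mon, reflY_apply]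
      simp only [mul_sub, sub_mul, mon_mul_mon, mul_one, one_mul]
      norm_num
      ring)
    (by rw [← hΩ]; ring)
  have h₀ := monCoeff_eq_zero_of_antisymm (v := (i, 0)) (by simp [reflY_apply]) h
  have h₁ : mon k (-1) 1 * den₂ α * (stepSum k ^ n * Ω) = mon k (-1) 1 * (stepSum k ^ n * Ω) -
      α • (mon k 1 (-1) * (stepSum k ^ n * Ω) + mon k 1 0 * (stepSum k ^ n * Ω) +
        mon k (-1) 0 * (stepSum k ^ n * Ω)) := by
    have e₁ : mon k 1 (-1) = mon k (-1) 1 * mon k 2 (-2) := by rw [mon_mul_mon]; norm_num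
    have e₂ : mon k 1 0 = mon k (-1) 1 * mon k 2 (-1) := by rw [mon_mul_mon]; norm_num
    have e₃ : mon k (-1) 0 = mon k (-1) 1 * mon k 0 (-1) := by rw [mon_mul_mon]; norm_num
    rw [e₁, e₂, e₃, den₂, Algebra.smul_def]
    ring
  rw [h₁, map_sub, map_smul, sub_eq_zero] at h₀
  simp only [map_add, monCoeff_mon_mul, sub_neg_eq_add, sub_zero, zero_sub, zero_add,
    smul_eq_mul] at h₀
  rw [h₀]
  ring

/-- The boundary relation on the vertical axis. -/
lemma monCoeff_vertical (hα : constantCoeff α = 0) (hβ : constantCoeff β = 0)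
    (hΩ : den₁ α * den₂ α * den₃ β * den₄ β * Ω = ansatzNum k) (n : ℕ) (j : ℤ) :
    monCoeff (-1, j) (stepSum k ^ n * Ω) + monCoeff (-1, j + 1) (stepSum k ^ n * Ω) =
      β * (monCoeff (1, j) (stepSum k ^ n * Ω) + monCoeff (1, j - 1) (stepSum k ^ n * Ω)) := by
  have hu : IsUnit (den₁ α * den₂ α * den₃ β) :=
    ((isUnit_one_sub_algebraMap_mul hα _).mul (isUnit_one_sub_algebraMap_mul hα _)).mul
      (isUnit_one_sub_algebraMap_mul hβ _)
  have hS : monSubst reflX (stepSum k) = stepSum k := by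
    simp only [stepSum, map_add, monSubst_mon, reflX_apply]
    norm_num
    ring
  have h := antisymm_of_mul (σ := monSubst reflX)
    (U := mon k 1 0 * (1 + mon k 0 (-1)) * den₄ β * (stepSum k ^ n * Ω))
    (N := mon k 1 0 * ansatzNum k * (1 + mon k 0 (-1)) * stepSum k ^ n) hu
    (by
      simp only [den₁, den₂, den₃, map_add, map_sub, map_mul, map_one, monSubst_mon,
        monSubst_algebraMap, reflX_apply]
      norm_num
      left
      ring)
    (by
      rw [map_mul, map_pow, hS, map_mul]
      simp only [ansatzNum, map_add, map_sub, map_mul, map_one, monSubst_mon, reflX_apply]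
      simp only [mul_sub, sub_mul, mon_mul_mon, mul_one, one_mul]
      norm_num
      ring)
    (by rw [← hΩ]; ring)
  have h₀ := monCoeff_eq_zero_of_antisymm (v := (0, j)) (by simp [reflX_apply]) h
  have h₁ : mon k 1 0 * (1 + mon k 0 (-1)) * den₄ β * (stepSum k ^ n * Ω) =
      mon k 1 0 * (stepSum k ^ n * Ω) + mon k 1 (-1) * (stepSum k ^ n * Ω) -
      β • (mon k (-1) 1 * (stepSum k ^ n * Ω) + mon k (-1) 0 * (stepSum k ^ n * Ω)) := by
    have e₁ : mon k 1 (-1) = mon k 1 0 * mon k 0 (-1) := by rw [mon_mul_mon]; norm_num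
    have e₂ : mon k (-1) 1 = mon k 1 0 * mon k (-2) 1 := by rw [mon_mul_mon]; norm_num
    have e₃ : mon k (-1) 0 = mon k 1 0 * mon k 0 (-1) * mon k (-2) 1 := by
      rw [mon_mul_mon, mon_mul_mon]; norm_num
    rw [e₁, e₂, e₃, den₄, Algebra.smul_def]
    ring
  rw [h₁, map_sub, map_smul, sub_eq_zero] at h₀
  simp only [map_add, monCoeff_mon_mul, sub_neg_eq_add, sub_zero, zero_sub, zero_add,
    smul_eq_mul] at h₀
  rw [h₀]
  ring

end Ansatz

section Support

variable {k : Type*} [CommRing k]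

/-- The Laurent polynomials supported on exponents of weight at most `m`. -/
def weightLE (k : Type*) [CommRing k] (l : ℤ × ℤ →+ ℤ) (m : ℤ) :
    AddSubgroup (AddMonoidAlgebra k (ℤ × ℤ)) where
  carrier := {f | ∀ v, m < l v → f.coeff v = 0}
  zero_mem' v _ := by simp
  add_mem' {f g} hf hg v hv := by simp [hf v hv, hg v hv]
  neg_mem' {f} hf v hv := by simp [hf v hv]

lemma mul_mem_weightLE {l : ℤ × ℤ →+ ℤ} {m m' : ℤ} {f g : AddMonoidAlgebra k (ℤ × ℤ)}
    (hf : f ∈ weightLE k l m) (hg : g ∈ weightLE k l m') : f * g ∈ weightLE k l (m + m') := by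
  classical
  intro v hv
  by_contra h
  obtain ⟨u, hu, w, hw, rfl⟩ := Finset.mem_add.1
    (AddMonoidAlgebra.support_coeff_mul_subset f g (Finsupp.mem_support_iff.2 h))
  have h₁ : l u ≤ m := by
    by_contra! h'
    exact Finsupp.mem_support_iff.1 hu (hf u h')
  have h₂ : l w ≤ m' := by
    by_contra! h'
    exact Finsupp.mem_support_iff.1 hw (hg w h')
  rw [map_add] at hv
  omega

/-- The series all of whose coefficients are supported on exponents of weight at most `m`. -/
def seriesWeightLE (k : Type*) [CommRing k] (l : ℤ × ℤ →+ ℤ) (m : ℤ) :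
    AddSubgroup (BiLaurent k) where
  carrier := {F | ∀ n, coeff n F ∈ weightLE k l m}
  zero_mem' n := by simp
  add_mem' {f g} hf hg n := by rw [map_add]; exact add_mem (hf n) (hg n)
  neg_mem' {f} hf n := by rw [map_neg]; exact neg_mem (hf n)

variable {l : ℤ × ℤ →+ ℤ} {m m' : ℤ} {F G : BiLaurent k}

lemma mul_mem_seriesWeightLE (hF : F ∈ seriesWeightLE k l m) (hG : G ∈ seriesWeightLE k l m') :
    F * G ∈ seriesWeightLE k l (m + m') := fun n => by
  rw [coeff_mul]
  exact sum_mem fun p _ => mul_mem_weightLE (hF _) (hG _)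

lemma mul_mem_seriesWeightLE_zero (hF : F ∈ seriesWeightLE k l 0) (hG : G ∈ seriesWeightLE k l 0) :
    F * G ∈ seriesWeightLE k l 0 := by
  simpa using mul_mem_seriesWeightLE hF hG

lemma monCoeff_eq_zero (hF : F ∈ seriesWeightLE k l m) {v : ℤ × ℤ} (hv : m < l v) :
    monCoeff v F = 0 := by
  ext n
  rw [coeff_monCoeff, hF n v hv, map_zero]

lemma C_mem_seriesWeightLE {f : AddMonoidAlgebra k (ℤ × ℤ)} (hf : f ∈ weightLE k l m) :
    PowerSeries.C f ∈ seriesWeightLE k l m := fun n => by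
  rw [coeff_C]
  split_ifs
  exacts [hf, zero_mem _]

lemma single_mem_weightLE {v : ℤ × ℤ} (c : k) (hv : l v ≤ m) :
    AddMonoidAlgebra.single v c ∈ weightLE k l m := fun w hw => by
  rw [AddMonoidAlgebra.coeff_single, Finsupp.single_apply, if_neg]
  rintro rfl
  omega

lemma mon_mem_seriesWeightLE {i j : ℤ} (h : l (i, j) ≤ m) : mon k i j ∈ seriesWeightLE k l m :=
  C_mem_seriesWeightLE (single_mem_weightLE 1 h)

lemma one_mem_seriesWeightLE : (1 : BiLaurent k) ∈ seriesWeightLE k l 0 := by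
  rw [← mon_zero]
  exact mon_mem_seriesWeightLE (map_zero l).le

lemma algebraMap_mul_mem_seriesWeightLE (r : k⟦X⟧) (hF : F ∈ seriesWeightLE k l m) :
    algebraMap k⟦X⟧ (BiLaurent k) r * F ∈ seriesWeightLE k l m := by
  rw [← zero_add m]
  refine mul_mem_seriesWeightLE (fun n => ?_) hF
  rw [algebraMap_apply'', coeff_map]
  exact single_mem_weightLE _ (map_zero l).le

lemma mem_seriesWeightLE_of_one_sub_mul_eq_one (h : constantCoeff F = 0)
    (hF : F ∈ seriesWeightLE k l 0) (hG : (1 - F) * G = 1) : G ∈ seriesWeightLE k l 0 := fun n => by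
  induction n using Nat.strong_induction_on with
  | _ n ih =>
    rw [show G = 1 + F * G by linear_combination hG, map_add, coeff_mul]
    refine add_mem (one_mem_seriesWeightLE n) (sum_mem fun p hp => ?_)
    rw [Finset.HasAntidiagonal.mem_antidiagonal] at hp
    rcases Nat.eq_zero_or_pos p.1 with h' | h'
    · rw [h', coeff_zero_eq_constantCoeff_apply, h, zero_mul]
      exact zero_mem _
    · have := mul_mem_weightLE (hF p.1) (ih p.2 (by omega))
      simpa using this

lemma mul_sub_mul_mem_seriesWeightLE {F' G' : BiLaurent k} (hG : G ∈ seriesWeightLE k l 0)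
    (hF' : F' ∈ seriesWeightLE k l 0) (h : F - F' ∈ seriesWeightLE k l m)
    (h' : G - G' ∈ seriesWeightLE k l m) : F * G - F' * G' ∈ seriesWeightLE k l m := by
  rw [show F * G - F' * G' = (F - F') * G + F' * (G - G') by ring]
  refine add_mem ?_ ?_
  · simpa using mul_mem_seriesWeightLE h hG
  · simpa using mul_mem_seriesWeightLE hF' h'

lemma sub_mem_seriesWeightLE_of_mul_eq_one {F' G' : BiLaurent k} (hG : G ∈ seriesWeightLE k l 0)
    (hG' : G' ∈ seriesWeightLE k l 0) (hFG : F * G = 1) (hFG' : F' * G' = 1)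
    (h : F' - F ∈ seriesWeightLE k l m) : G - G' ∈ seriesWeightLE k l m := by
  rw [show G - G' = G * ((F' - F) * G') by linear_combination G' * hFG - G * hFG']
  simpa using mul_mem_seriesWeightLE hG (mul_mem_seriesWeightLE h hG')

end Support

section InitialValues

variable {k : Type*} [CommRing k] {α β : k⟦X⟧} {Ω : BiLaurent k}

lemma exists_mul_eq_one {α : k⟦X⟧} (hα : constantCoeff α = 0) (F : BiLaurent k) :
    ∃ G, (1 - algebraMap k⟦X⟧ (BiLaurent k) α * F) * G = 1 ∧
      ∀ l, F ∈ seriesWeightLE k l 0 → G ∈ seriesWeightLE k l 0 := by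
  obtain ⟨G, hG⟩ := (isUnit_one_sub_algebraMap_mul hα F).exists_right_inv
  refine ⟨G, hG, fun l hF => mem_seriesWeightLE_of_one_sub_mul_eq_one ?_
    (algebraMap_mul_mem_seriesWeightLE α hF) hG⟩
  rw [map_mul, algebraMap_apply'', ← coeff_zero_eq_constantCoeff_apply, coeff_map,
      coeff_zero_eq_constantCoeff_apply, hα, map_zero, zero_mul]

/-- The linear form `(i, j) ↦ p * i + q * j`. -/
def linearWeight (p q : ℤ) : ℤ × ℤ →+ ℤ where
  toFun v := p * v.1 + q * v.2
  map_zero' := by simp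
  map_add' v w := by simp; ring

lemma linearWeight_apply (p q : ℤ) (v : ℤ × ℤ) : linearWeight p q v = p * v.1 + q * v.2 := rfl

/-- Up to terms of negative weight, the Bethe ansatz is a series in the monomial `(-2, 1)`. -/
lemma exists_leading_part (hα : constantCoeff α = 0) (hβ : constantCoeff β = 0)
    (hΩ : den₁ α * den₂ α * den₃ β * den₄ β * Ω = ansatzNum k) :
    Ω ∈ seriesWeightLE k (linearWeight 1 2) 0 ∧
      ∃ j₁ j₂ i₄ : BiLaurent k,
        (1 - algebraMap k⟦X⟧ _ α * mon k (-2) 1) * j₁ = 1 ∧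
        (1 - algebraMap k⟦X⟧ _ α * mon k 2 (-1)) * j₂ = 1 ∧
        (1 - algebraMap k⟦X⟧ _ β * mon k (-2) 1) * i₄ = 1 ∧
        j₁ ∈ seriesWeightLE k (linearWeight 0 (-1)) 0 ∧
        j₂ ∈ seriesWeightLE k (linearWeight 0 1) 0 ∧
        i₄ ∈ seriesWeightLE k (linearWeight 0 (-1)) 0 ∧
        Ω - (1 - mon k (-2) 1) * j₁ * j₂ * i₄ ∈ seriesWeightLE k (linearWeight 1 2) (-1) := by
  obtain ⟨j₁, hj₁, hj₁'⟩ := exists_mul_eq_one hα (mon k (-2) 1)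
  obtain ⟨j₂, hj₂, hj₂'⟩ := exists_mul_eq_one hα (mon k 2 (-1))
  obtain ⟨i₁, hi₁, hi₁'⟩ := exists_mul_eq_one hα (mon k (-2) 0 + mon k (-2) 1 + mon k 0 (-1))
  obtain ⟨i₂, hi₂, hi₂'⟩ := exists_mul_eq_one hα (mon k 2 (-2) + mon k 2 (-1) + mon k 0 (-1))
  obtain ⟨i₃, hi₃, hi₃'⟩ := exists_mul_eq_one hβ (mon k 0 (-1))
  obtain ⟨i₄, hi₄, hi₄'⟩ := exists_mul_eq_one hβ (mon k (-2) 1)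
  have hm {i j m : ℤ} (h : i + 2 * j ≤ m) : mon k i j ∈ seriesWeightLE k (linearWeight 1 2) m :=
    mon_mem_seriesWeightLE (by simpa [linearWeight_apply] using h)
  have h1 := one_mem_seriesWeightLE (k := k) (l := linearWeight 1 2)
  replace hi₁' := hi₁' (linearWeight 1 2)
    (add_mem (add_mem (hm (by norm_num)) (hm (by norm_num))) (hm (by norm_num)))
  replace hi₂' := hi₂' (linearWeight 1 2)
    (add_mem (add_mem (hm (by norm_num)) (hm (by norm_num))) (hm (by norm_num)))
  replace hi₃' := hi₃' (linearWeight 1 2) (hm (by norm_num))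
  have hΩ' : Ω = (1 - mon k (-2) 0) * (1 - mon k 2 (-2)) * (1 - mon k 0 (-1)) *
      (1 - mon k (-2) 1) * i₁ * i₂ * i₃ * i₄ := by
    have e : (den₁ α * i₁) * (den₂ α * i₂) * (den₃ β * i₃) * (den₄ β * i₄) = 1 := by
      rw [den₁, den₂, den₃, den₄, hi₁, hi₂, hi₃, hi₄]
      ring
    rw [← ansatzNum, ← hΩ]
    linear_combination -Ω * e
  have hs₁ : 1 - mon k (-2) 0 ∈ seriesWeightLE k (linearWeight 1 2) 0 :=
    sub_mem h1 (hm (by norm_num))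
  have hs₂ : 1 - mon k 2 (-2) ∈ seriesWeightLE k (linearWeight 1 2) 0 :=
    sub_mem h1 (hm (by norm_num))
  have hs₃ : 1 - mon k 0 (-1) ∈ seriesWeightLE k (linearWeight 1 2) 0 :=
    sub_mem h1 (hm (by norm_num))
  have hs₄ : 1 - mon k (-2) 1 ∈ seriesWeightLE k (linearWeight 1 2) 0 :=
    sub_mem h1 (hm (by norm_num))
  have hJ₁ := hj₁' (linearWeight 1 2) (hm (by norm_num))
  have hJ₂ := hj₂' (linearWeight 1 2) (hm (by norm_num))
  have hI₄ := hi₄' (linearWeight 1 2) (hm (by norm_num))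
  have hd₁ : i₁ - j₁ ∈ seriesWeightLE k (linearWeight 1 2) (-1) := by
    refine sub_mem_seriesWeightLE_of_mul_eq_one hi₁' hJ₁ hi₁ hj₁ ?_
    convert algebraMap_mul_mem_seriesWeightLE α
      (add_mem (hm (i := -2) (j := 0) (m := -1) (by norm_num))
        (hm (i := 0) (j := -1) (by norm_num))) using 1
    ring
  have hd₂ : i₂ - j₂ ∈ seriesWeightLE k (linearWeight 1 2) (-1) := by
    refine sub_mem_seriesWeightLE_of_mul_eq_one hi₂' hJ₂ hi₂ hj₂ ?_
    convert algebraMap_mul_mem_seriesWeightLE α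
      (add_mem (hm (i := 2) (j := -2) (m := -1) (by norm_num))
        (hm (i := 0) (j := -1) (by norm_num))) using 1
    ring
  have hd₃ : i₃ - 1 ∈ seriesWeightLE k (linearWeight 1 2) (-1) := by
    refine sub_mem_seriesWeightLE_of_mul_eq_one hi₃' h1 hi₃ (one_mul 1) ?_
    convert algebraMap_mul_mem_seriesWeightLE β
      (hm (i := 0) (j := -1) (m := -1) (by norm_num)) using 1
    ring
  have hn {i j : ℤ} (h : i + 2 * j ≤ -1) :
      (1 - mon k i j) - 1 ∈ seriesWeightLE k (linearWeight 1 2) (-1) := by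
    rw [sub_sub_cancel_left]
    exact neg_mem (hm h)
  have hz (F : BiLaurent k) : F - F ∈ seriesWeightLE k (linearWeight 1 2) (-1) := by
    rw [sub_self]
    exact zero_mem _
  have hmul {F G : BiLaurent k} :=
    mul_mem_seriesWeightLE_zero (l := linearWeight 1 2) (F := F) (G := G)
  refine ⟨?_, j₁, j₂, i₄, hj₁, hj₂, hi₄, ?_, ?_, ?_, ?_⟩
  · rw [hΩ']
    exact hmul (hmul (hmul (hmul (hmul (hmul (hmul hs₁ hs₂) hs₃) hs₄) hi₁') hi₂') hi₃') hI₄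
  · exact hj₁' _ (mon_mem_seriesWeightLE (by simp [linearWeight_apply]))
  · exact hj₂' _ (mon_mem_seriesWeightLE (by simp [linearWeight_apply]))
  · exact hi₄' _ (mon_mem_seriesWeightLE (by simp [linearWeight_apply]))
  · rw [hΩ', show (1 - mon k (-2) 1) * j₁ * j₂ * i₄ =
      1 * 1 * 1 * (1 - mon k (-2) 1) * j₁ * j₂ * 1 * i₄ by ring]
    have c₁ := mul_sub_mul_mem_seriesWeightLE hs₂ h1 (hn (i := -2) (j := 0) (by norm_num))
      (hn (i := 2) (j := -2) (by norm_num))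
    have c₂ := mul_sub_mul_mem_seriesWeightLE hs₃ (hmul h1 h1) c₁
      (hn (i := 0) (j := -1) (by norm_num))
    have c₃ := mul_sub_mul_mem_seriesWeightLE hs₄ (hmul (hmul h1 h1) h1) c₂ (hz (1 - mon k (-2) 1))
    have c₄ := mul_sub_mul_mem_seriesWeightLE hi₁' (hmul (hmul (hmul h1 h1) h1) hs₄) c₃ hd₁
    have c₅ := mul_sub_mul_mem_seriesWeightLE hi₂' (hmul (hmul (hmul (hmul h1 h1) h1) hs₄) hJ₁)
      c₄ hd₂
    have c₆ := mul_sub_mul_mem_seriesWeightLE hi₃'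
      (hmul (hmul (hmul (hmul (hmul h1 h1) h1) hs₄) hJ₁) hJ₂) c₅ hd₃
    exact mul_sub_mul_mem_seriesWeightLE hI₄
      (hmul (hmul (hmul (hmul (hmul (hmul h1 h1) h1) hs₄) hJ₁) hJ₂) h1) c₆ (hz i₄)

lemma monCoeff_ansatz_eq_zero (hα : constantCoeff α = 0) (hβ : constantCoeff β = 0)
    (hΩ : den₁ α * den₂ α * den₃ β * den₄ β * Ω = ansatzNum k) {v : ℤ × ℤ}
    (hv : 0 < v.1 + 2 * v.2) : monCoeff v Ω = 0 :=
  monCoeff_eq_zero (exists_leading_part hα hβ hΩ).1 (by simpa [linearWeight_apply] using hv)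

lemma monCoeff_ansatz_zero (hα : constantCoeff α = 0) (hβ : constantCoeff β = 0)
    (hΩ : den₁ α * den₂ α * den₃ β * den₄ β * Ω = ansatzNum k) :
    (1 + α) * (1 - α * β) * monCoeff (0, 0) Ω = 1 := by
  obtain ⟨-, j₁, j₂, i₄, hj₁, hj₂, hi₄, hj₁', hj₂', hi₄', h⟩ := exists_leading_part hα hβ hΩ
  have h₁ := monCoeff_eq_zero h (v := (0, 0)) (by simp [linearWeight_apply])
  rw [map_sub, sub_eq_zero] at h₁
  rw [h₁, ← smul_eq_mul, ← map_smul]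
  have hξ : mon k (-2) 1 * mon k 2 (-1) = 1 := by
    rw [mon_mul_mon, ← mon_zero]
    norm_num
  have key : ((1 + α) * (1 - α * β)) • ((1 - mon k (-2) 1) * j₁ * j₂ * i₄) =
      1 + α • (mon k 2 (-1) * j₂) +
      mon k (-2) 1 * ((-(α * β)) • (mon k (-2) 1 * (j₁ * i₄)) - (1 - β - α * β) • (j₁ * i₄)) := by
    simp only [Algebra.smul_def, map_mul, map_add, map_sub, map_one, map_neg]
    set a := algebraMap k⟦X⟧ (BiLaurent k) α
    set b := algebraMap k⟦X⟧ (BiLaurent k) β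
    set ξ := mon k (-2) 1
    set η := mon k 2 (-1)
    have e : (1 - a * ξ) * j₁ * ((1 - b * ξ) * i₄) = 1 := by rw [hj₁, hi₄, one_mul]
    linear_combination j₂ * e + (ξ * (-a * b * ξ - (1 - b - a * b)) * j₁ * i₄ + 1) * hj₂ +
      j₁ * j₂ * i₄ * a * (-a * b * ξ - (1 - b - a * b)) * hξ
  have hji := mul_mem_seriesWeightLE_zero hj₁' hi₄'
  have hr : (-(α * β)) • (mon k (-2) 1 * (j₁ * i₄)) - (1 - β - α * β) • (j₁ * i₄) ∈
      seriesWeightLE k (linearWeight 0 (-1)) 0 := by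
    rw [Algebra.smul_def, Algebra.smul_def]
    exact sub_mem (algebraMap_mul_mem_seriesWeightLE _ (mul_mem_seriesWeightLE_zero
      (mon_mem_seriesWeightLE (by simp [linearWeight_apply])) hji))
      (algebraMap_mul_mem_seriesWeightLE _ hji)
  rw [key, map_add, map_add, map_smul, monCoeff_one, monCoeff_mon_mul, monCoeff_mon_mul,
    monCoeff_eq_zero hj₂' (by simp [linearWeight_apply]),
    monCoeff_eq_zero hr (by simp [linearWeight_apply]), smul_zero, add_zero, add_zero]

end InitialValues

section Walks

/-- The steps of Model 22. -/
abbrev model22 : Set (ℤ × ℤ) := {((1 : ℤ), (0 : ℤ)), (-1, 0), (-1, 1), (1, -1)}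

open Classical in
/-- The points of the quarter plane which can be reached from `v` in one step of Model 22. -/
noncomputable def neighbours (v : ℕ × ℕ) : Finset (ℕ × ℕ) :=
  (Finset.range (v.1 + 2) ×ˢ Finset.range (v.2 + 2)).filter
    fun u => ((u.1 : ℤ) - v.1, (u.2 : ℤ) - v.2) ∈ model22

lemma mem_neighbours {u v : ℕ × ℕ} :
    u ∈ neighbours v ↔ ((u.1 : ℤ) - v.1, (u.2 : ℤ) - v.2) ∈ model22 := by
  simp only [neighbours, Finset.mem_filter, Finset.mem_product, Finset.mem_range,
    Set.mem_insert_iff, Set.mem_singleton_iff, Prod.mk.injEq]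
  omega

variable {M : Type*} [AddCommMonoid M] (f : ℕ × ℕ → M)

lemma sum_neighbours_interior (i j : ℕ) : ∑ u ∈ neighbours (i + 1, j + 1), f u =
    f (i + 2, j + 1) + f (i, j + 1) + f (i, j + 2) + f (i + 2, j) := by
  have h : neighbours (i + 1, j + 1) = {(i + 2, j + 1), (i, j + 1), (i, j + 2), (i + 2, j)} := by
    ext u
    simp only [mem_neighbours, Finset.mem_insert, Finset.mem_singleton, Prod.ext_iff,
      Set.mem_insert_iff, Set.mem_singleton_iff]
    push_cast
    omega
  rw [h, Finset.sum_insert (by simp), Finset.sum_insert (by simp), Finset.sum_insert (by simp),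
    Finset.sum_singleton]
  simp only [add_assoc]

lemma sum_neighbours_horizontal (i : ℕ) : ∑ u ∈ neighbours (i + 1, 0), f u =
    f (i + 2, 0) + f (i, 0) + f (i, 1) := by
  have h : neighbours (i + 1, 0) = {(i + 2, 0), (i, 0), (i, 1)} := by
    ext u
    simp only [mem_neighbours, Finset.mem_insert, Finset.mem_singleton, Prod.ext_iff,
      Set.mem_insert_iff, Set.mem_singleton_iff]
    push_cast
    omega
  rw [h, Finset.sum_insert (by simp), Finset.sum_insert (by simp), Finset.sum_singleton]
  simp only [add_assoc]

lemma sum_neighbours_vertical (j : ℕ) : ∑ u ∈ neighbours (0, j + 1), f u =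
    f (1, j + 1) + f (1, j) := by
  have h : neighbours (0, j + 1) = {(1, j + 1), (1, j)} := by
    ext u
    simp only [mem_neighbours, Finset.mem_insert, Finset.mem_singleton, Prod.ext_iff,
      Set.mem_insert_iff, Set.mem_singleton_iff]
    push_cast
    omega
  rw [h, Finset.sum_insert (by simp), Finset.sum_singleton]

lemma sum_neighbours_zero : ∑ u ∈ neighbours (0, 0), f u = f (1, 0) := by
  have h : neighbours (0, 0) = {(1, 0)} := by
    ext u
    simp only [mem_neighbours, Finset.mem_singleton, Prod.ext_iff,
      Set.mem_insert_iff, Set.mem_singleton_iff]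
    push_cast
    omega
  rw [h, Finset.sum_singleton]

/-- The walks in the quarter plane of length `n` with steps in Model 22 which go from `v` to the
origin. -/
noncomputable def walksToOrigin : (n : ℕ) → ℕ × ℕ → Finset (Fin (n + 1) → ℕ × ℕ)
  | 0, v => if v = (0, 0) then {fun _ => (0, 0)} else ∅
  | n + 1, v => (neighbours v).biUnion fun u =>
      (walksToOrigin n u).image (Fin.cons (α := fun _ => ℕ × ℕ) v)

lemma mem_walksToOrigin {n : ℕ} {v : ℕ × ℕ} {w : Fin (n + 1) → ℕ × ℕ} :
    w ∈ walksToOrigin n v ↔ w 0 = v ∧ w (Fin.last n) = (0, 0) ∧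
      ∀ i : Fin n, w i.succ ∈ neighbours (w i.castSucc) := by
  induction n generalizing v with
  | zero =>
    rw [walksToOrigin]
    constructor
    · intro h
      split_ifs at h with hv
      · rw [Finset.mem_singleton] at h
        subst h hv
        simp
      · simp at h
    · rintro ⟨h₁, h₂, -⟩
      rw [if_pos (h₁.symm.trans h₂), Finset.mem_singleton]
      funext i
      rw [Fin.eq_zero i, ← h₂]
      rfl
  | succ n ih =>
    simp only [walksToOrigin, Finset.mem_biUnion, Finset.mem_image]
    constructor
    · rintro ⟨u, hu, w', hw', rfl⟩
      obtain ⟨h₁, h₂, h₃⟩ := ih.1 hw'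
      refine ⟨rfl, by rwa [← Fin.succ_last, Fin.cons_succ], fun i => ?_⟩
      cases i using Fin.cases with
      | zero => simpa [h₁] using hu
      | succ i =>
        rw [← Fin.succ_castSucc, Fin.cons_succ, Fin.cons_succ]
        exact h₃ i
    · rintro ⟨h₁, h₂, h₃⟩
      refine ⟨w 1, by simpa [h₁] using h₃ 0, Fin.tail w, ih.2 ⟨rfl, h₂, fun i => ?_⟩, ?_⟩
      · exact h₃ i.succ
      · rw [← h₁, Fin.cons_self_tail]

variable {R : Type*} [CommRing R] (a b : R)

/-- The weight of a visit at `v`. -/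
def visitWeight (v : ℕ × ℕ) : R := (if v.2 = 0 then a else 1) * if v.1 = 0 then b else 1

/-- The weighted number of walks of length `n` from `v` to the origin. -/
noncomputable def walkSum : ℕ → ℕ × ℕ → R
  | 0, v => if v = (0, 0) then 1 else 0
  | n + 1, v => ∑ u ∈ neighbours v, visitWeight a b u * walkSum n u

lemma sum_walksToOrigin (n : ℕ) (v : ℕ × ℕ) :
    ∑ w ∈ walksToOrigin n v, ∏ i : Fin n, visitWeight a b (w i.succ) = walkSum a b n v := by
  induction n generalizing v with
  | zero =>
    rw [walksToOrigin, walkSum]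
    split_ifs <;> simp
  | succ n ih =>
    rw [walksToOrigin, walkSum, Finset.sum_biUnion]
    · refine Finset.sum_congr rfl fun u _ => ?_
      rw [Finset.sum_image fun _ _ _ _ h => Fin.cons_right_injective (α := fun _ => ℕ × ℕ) v h,
        ← ih, Finset.mul_sum]
      refine Finset.sum_congr rfl fun w hw => ?_
      rw [Fin.prod_univ_succ]
      simp [(mem_walksToOrigin.1 hw).1]
    · intro u _ u' _ huu'
      rw [Function.onFun, Finset.disjoint_left]
      intro w hw hw'
      simp only [Finset.mem_image] at hw hw'
      obtain ⟨w₁, h₁, rfl⟩ := hw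
      obtain ⟨w₂, h₂, h₃⟩ := hw'
      rw [Fin.cons_right_injective (α := fun _ => ℕ × ℕ) v h₃] at h₂
      exact huu' ((mem_walksToOrigin.1 h₁).1.symm.trans (mem_walksToOrigin.1 h₂).1)

lemma prod_visitWeight {n : ℕ} (w : Fin (n + 1) → ℕ × ℕ) :
    ∏ i : Fin n, visitWeight a b (w i.succ) = a ^ hvisits w * b ^ vvisits w := by
  have h (p : ℕ × ℕ → Prop) [DecidablePred p] (c : R) :
      ∏ i : Fin n, (if p (w i.succ) then c else 1) =
        c ^ (Finset.univ.filter fun i : Fin (n + 1) => 0 < (i : ℕ) ∧ p (w i)).card := by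
    rw [← Finset.prod_const, Finset.prod_filter, Fin.prod_univ_succ]
    simp
  simp only [visitWeight, Finset.prod_mul_distrib]
  rw [h (fun v => v.2 = 0), h (fun v => v.1 = 0)]
  rfl

theorem coeff_loopGF (n : ℕ) : coeff n (loopGF model22 a b) = walkSum a b n (0, 0) := by
  have h (w : Fin (n + 1) → ℕ × ℕ) : IsQPLoop model22 n w ↔ w ∈ walksToOrigin n (0, 0) := by
    simp only [mem_walksToOrigin, mem_neighbours, IsQPLoop]
  rw [loopGF, coeff_mk, ← sum_walksToOrigin, ← finsum_mem_coe_finset]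
  rw [finsum_subtype_eq_finsum_cond (f := fun w => a ^ hvisits w * b ^ vvisits w)]
  simp only [h, prod_visitWeight, Finset.mem_coe]

end Walks

section Comparison

variable {K : Type*} [CommRing K]

lemma map_walkSum {R : Type*} [CommRing R] (ρ : R →+* K) (a b : R) (n : ℕ) (v : ℕ × ℕ) :
    ρ (walkSum a b n v) = walkSum (ρ a) (ρ b) n v := by
  have h (u : ℕ × ℕ) : ρ (visitWeight a b u) = visitWeight (ρ a) (ρ b) u := by
    rw [visitWeight, visitWeight]
    split_ifs <;> simp
  induction n generalizing v with
  | zero => rw [walkSum, walkSum]; split_ifs <;> simp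
  | succ n ih => simp only [walkSum, map_sum, map_mul, h, ih]

lemma map_loopGF {R : Type*} [CommRing R] (ρ : R →+* K) (a b : R) :
    PowerSeries.map ρ (loopGF model22 a b) = loopGF model22 (ρ a) (ρ b) := by
  ext n
  rw [coeff_map, coeff_loopGF, coeff_loopGF, map_walkSum]

lemma eq_zero_of_eq_X_mul_sum {d : ℕ × ℕ → K⟦X⟧} {c : ℕ × ℕ → K}
    (h : ∀ v, d v = PowerSeries.C (c v) * (X * ∑ u ∈ neighbours v, d u)) (v : ℕ × ℕ) : d v = 0 := by
  ext n
  induction n generalizing v with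
  | zero => rw [h]; simp
  | succ n ih =>
    rw [h, coeff_C_mul, coeff_succ_X_mul, map_sum, Finset.sum_eq_zero fun u _ => ih u]
    simp

/-- A family satisfying the recursion of the weighted walks, except at the origin, determines the
generating function of loops. -/
theorem loopGF_of_recursion [IsDomain K] {α β : K} (ha : 1 + α ≠ 0) (hb : 1 + β ≠ 0)
    {g : ℕ × ℕ → K⟦X⟧}
    (hg : ∀ v, v ≠ (0, 0) → g v =
      PowerSeries.C (visitWeight (1 + α) (1 + β) v) * (X * ∑ u ∈ neighbours v, g u))
    (hg₀ : PowerSeries.C ((1 + α) * (1 - α * β)) * g (0, 0) =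
      1 + PowerSeries.C ((1 + α) ^ 2 * (1 + β)) * (X * g (1, 0))) :
    (1 + PowerSeries.C (α * β) * (PowerSeries.C (1 + α) * g (0, 0))) *
      loopGF model22 (1 + α) (1 + β) = PowerSeries.C (1 + α) * g (0, 0) := by
  set a := 1 + α
  set b := 1 + β
  let W (v : ℕ × ℕ) : K⟦X⟧ := mk fun n => walkSum a b n v
  let L (v : ℕ × ℕ) : K⟦X⟧ := PowerSeries.C (visitWeight a b v) * W v
  have hG : loopGF model22 a b = W (0, 0) := by
    ext n
    rw [coeff_loopGF, coeff_mk]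
  have hW (v : ℕ × ℕ) : W v = (if v = (0, 0) then 1 else 0) + X * ∑ u ∈ neighbours v, L u := by
    ext n
    cases n with
    | zero =>
      simp only [W, coeff_mk, walkSum]
      split_ifs <;> simp
    | succ n =>
      rw [map_add, coeff_succ_X_mul, map_sum]
      simp only [W, L, coeff_mk, walkSum, coeff_C_mul]
      split_ifs <;> simp [coeff_one]
  have hw : visitWeight a b (0, 0) = a * b := by simp [visitWeight]
  set κ := 1 + PowerSeries.C (α * β) * (PowerSeries.C a * g (0, 0)) with hκ
  have hd := eq_zero_of_eq_X_mul_sum (d := fun v => PowerSeries.C (a ^ 2 * b) * g v - κ * L v)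
    (c := visitWeight a b) (fun v => by
      by_cases hv : v = (0, 0)
      · subst hv
        simp only [sum_neighbours_zero]
        have h₁ : L (0, 0) = PowerSeries.C (a * b) * (1 + X * L (1, 0)) := by
          simp only [L]
          rw [hw, hW, sum_neighbours_zero, if_pos rfl]
        rw [h₁, hw, hκ]
        simp only [map_mul, map_pow, map_sub, map_one] at hg₀ ⊢
        linear_combination (PowerSeries.C a * PowerSeries.C b) * hg₀
      · have h₁ : L v = PowerSeries.C (visitWeight a b v) * (X * ∑ u ∈ neighbours v, L u) := by
          conv_lhs => simp only [L]
          rw [hW, if_neg hv, zero_add]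
        simp only [Finset.sum_sub_distrib, ← Finset.mul_sum]
        linear_combination PowerSeries.C (a ^ 2 * b) * hg v hv - κ * h₁) (0, 0)
  have hab : PowerSeries.C (a * b) ≠ 0 := by
    rw [Ne, map_eq_zero_iff _ C_injective]
    exact mul_ne_zero ha hb
  refine mul_left_cancel₀ hab ?_
  rw [hG]
  simp only [L, hw] at hd
  simp only [map_mul, map_pow] at hd ⊢
  linear_combination -hd

variable {k : Type*} [CommRing k] {α β : k⟦X⟧} {Ω : BiLaurent k}

/-- The generating function of the coefficients of `S ^ n * Ω`. -/
noncomputable def ansatzSeries (Ω : BiLaurent k) (v : ℕ × ℕ) : k⟦X⟧⟦X⟧ :=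
  mk fun n => monCoeff ((v.1 : ℤ), (v.2 : ℤ)) (stepSum k ^ n * Ω)

lemma coeff_ansatzSeries (v : ℕ × ℕ) (n : ℕ) :
    coeff n (ansatzSeries Ω v) = monCoeff ((v.1 : ℤ), (v.2 : ℤ)) (stepSum k ^ n * Ω) :=
  coeff_mk ..

lemma one_add_ne_zero_of_constantCoeff [Nontrivial k] (hα : constantCoeff α = 0) :
    1 + α ≠ 0 := fun h => by
  have := congr_arg constantCoeff h
  simp [hα] at this

/-- The Bethe ansatz determines the generating function of loops. -/
theorem loopGF_of_ansatz [IsDomain k] [CharZero k] (hα : constantCoeff α = 0)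
    (hβ : constantCoeff β = 0)
    (hΩ : den₁ α * den₂ α * den₃ β * den₄ β * Ω = ansatzNum k) :
    (1 + PowerSeries.C (α * β) * (PowerSeries.C (1 + α) * ansatzSeries Ω (0, 0))) *
      loopGF model22 (1 + α) (1 + β) = PowerSeries.C (1 + α) * ansatzSeries Ω (0, 0) := by
  have hX (n : ℕ) (v : ℤ × ℤ) := monCoeff_stepSum_mul v (stepSum k ^ n * Ω)
  have hH := monCoeff_horizontal hα hβ hΩ
  have hV := monCoeff_vertical hα hβ hΩ
  refine loopGF_of_recursion (one_add_ne_zero_of_constantCoeff hα)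
    (one_add_ne_zero_of_constantCoeff hβ) (fun v hv => ?_) ?_
  · ext1 n
    cases n with
    | zero =>
      rw [coeff_ansatzSeries, pow_zero, one_mul, monCoeff_ansatz_eq_zero hα hβ hΩ]
      · simp
      · rcases v with ⟨_ | i, _ | j⟩ <;> (simp at hv ⊢; try positivity)
    | succ n =>
      rw [coeff_C_mul, coeff_succ_X_mul, map_sum, coeff_ansatzSeries, pow_succ', mul_assoc, hX]
      rcases v with ⟨_ | i, _ | j⟩
      · exact absurd rfl hv
      · rw [sum_neighbours_vertical]
        simp only [coeff_ansatzSeries, visitWeight]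
        have := hV n (j + 1)
        simp only [add_sub_cancel_right] at this
        push_cast
        simp only [add_sub_cancel_right]
        linear_combination this
      · rw [sum_neighbours_horizontal]
        simp only [coeff_ansatzSeries, visitWeight]
        have := hH n (i + 1)
        simp only [add_sub_cancel_right] at this
        push_cast
        simp only [add_sub_cancel_right, show (i : ℤ) + 1 + 1 = i + 2 by ring] at this ⊢
        linear_combination this
      · rw [sum_neighbours_interior]
        simp only [coeff_ansatzSeries, visitWeight]
        push_cast
        simp only [add_sub_cancel_right, show (i : ℤ) + 1 + 1 = i + 2 by ring,
          show (j : ℤ) + 1 + 1 = j + 2 by ring]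
        ring
  · ext1 n
    cases n with
    | zero =>
      rw [coeff_C_mul, coeff_ansatzSeries, pow_zero, one_mul]
      simpa using monCoeff_ansatz_zero hα hβ hΩ
    | succ n =>
      rw [coeff_C_mul, map_add, coeff_C_mul, coeff_succ_X_mul, coeff_ansatzSeries, pow_succ',
        mul_assoc (stepSum k), hX, coeff_ansatzSeries]
      have h₁ := hH n 0
      have h₂ := hV n 0
      simp only [zero_add, zero_sub, Nat.cast_zero, Nat.cast_one, coeff_one, Nat.add_eq_zero_iff,
        one_ne_zero, and_false, if_false] at h₁ h₂ ⊢
      linear_combination ((1 + α) * (1 + β)) * h₁ + (1 + α) ^ 2 * h₂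

end Comparison

section AnsatzEquation

variable {R k : Type*} [CommRing R] [CommRing k]

lemma coe_map_mem_adjoin {C : Type*} [CommRing C] [Algebra R C] (x y : C) (V : Polynomial R) :
    ((V.map (algebraMap R C) : Polynomial C) : C⟦X⟧) ∈
      Algebra.adjoin R {(X : C⟦X⟧), PowerSeries.C x, PowerSeries.C y} := by
  induction V using Polynomial.induction_on' with
  | add p q hp hq =>
    rw [Polynomial.map_add, Polynomial.coe_add]
    exact add_mem hp hq
  | monomial n r =>
    have h : ((Polynomial.map (algebraMap R C) (Polynomial.monomial n r) : Polynomial C) : C⟦X⟧) =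
        r • X ^ n := by
      ext m
      rw [Polynomial.map_monomial, Polynomial.coe_monomial, coeff_monomial, coeff_smul, coeff_X_pow,
        Algebra.smul_def]
      simp
    rw [h]
    exact Subalgebra.smul_mem _ (pow_mem (Algebra.subset_adjoin (by simp)) n) r

/-- Clearing denominators in the Bethe ansatz. -/
lemma exists_isUnit_mul_mem {T : Type*} [CommRing T] [Algebra R T] {𝔸 : Subalgebra R T}
    {x x' y y' a b t v w F : T} (hx : x ∈ 𝔸) (hy : y ∈ 𝔸) (ha : a ∈ 𝔸) (hb : b ∈ 𝔸) (ht : t ∈ 𝔸)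
    (hv : v ∈ 𝔸) (hw : w ∈ 𝔸) (hxx : x * x' = 1) (hyy : y * y' = 1)
    (h₁ : IsUnit (1 - a * (x' ^ 2 + x' ^ 2 * y + y')))
    (h₂ : IsUnit (1 - a * (x ^ 2 * y' ^ 2 + x ^ 2 * y' + y')))
    (h₃ : IsUnit (1 - b * y')) (h₄ : IsUnit (1 - b * (x' ^ 2 * y)))
    (h₅ : IsUnit (1 - t * (x + x' + x' * y + x * y')))
    (hF : (1 - a * (x' ^ 2 + x' ^ 2 * y + y')) * (1 - a * (x ^ 2 * y' ^ 2 + x ^ 2 * y' + y')) *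
      (1 - b * y') * (1 - b * (x' ^ 2 * y)) * (1 - t * (x + x' + x' * y + x * y')) * F =
      (1 - x' ^ 2) * (1 - x ^ 2 * y' ^ 2) * (1 - y') * (1 - x' ^ 2 * y)) :
    ∃ Q ∈ 𝔸, IsUnit Q ∧ Q * (x' * y' * (v + w * F)) ∈ 𝔸 := by
  have hx2 : x ^ 2 * x' ^ 2 = 1 := by rw [← mul_pow, hxx, one_pow]
  have hy2 : y ^ 2 * y' ^ 2 = 1 := by rw [← mul_pow, hyy, one_pow]
  have g₁ : x ^ 2 * y * (1 - a * (x' ^ 2 + x' ^ 2 * y + y')) =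
      x ^ 2 * y - a * (y + y ^ 2 + x ^ 2) := by
    linear_combination (-a * (y + y ^ 2)) * hx2 - a * x ^ 2 * hyy
  have g₂ : y ^ 2 * (1 - a * (x ^ 2 * y' ^ 2 + x ^ 2 * y' + y')) =
      y ^ 2 - a * (x ^ 2 + x ^ 2 * y + y) := by
    linear_combination (-a * x ^ 2) * hy2 - a * y * (x ^ 2 + 1) * hyy
  have g₃ : y * (1 - b * y') = y - b := by linear_combination -b * hyy
  have g₄ : x ^ 2 * (1 - b * (x' ^ 2 * y)) = x ^ 2 - b * y := by linear_combination -b * y * hx2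
  have g₅ : x * y * (1 - t * (x + x' + x' * y + x * y')) =
      x * y - t * (x ^ 2 * y + y + y ^ 2 + x ^ 2) := by
    linear_combination -t * (y + y ^ 2) * hxx - t * x ^ 2 * hyy
  have g₆ : x ^ 4 * y ^ 3 * ((1 - x' ^ 2) * (1 - x ^ 2 * y' ^ 2) * (1 - y') * (1 - x' ^ 2 * y)) =
      (x ^ 2 - 1) * (y ^ 2 - x ^ 2) * (y - 1) * (x ^ 2 - y) := by
    have i₁ : x ^ 2 * (1 - x' ^ 2) = x ^ 2 - 1 := by linear_combination -hx2
    have i₂ : y ^ 2 * (1 - x ^ 2 * y' ^ 2) = y ^ 2 - x ^ 2 := by linear_combination -x ^ 2 * hy2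
    have i₃ : y * (1 - y') = y - 1 := by linear_combination -hyy
    have i₄ : x ^ 2 * (1 - x' ^ 2 * y) = x ^ 2 - y := by linear_combination -y * hx2
    rw [← i₁, ← i₂, ← i₃, ← i₄]
    ring
  have hxu : IsUnit x := IsUnit.of_mul_eq_one _ hxx
  have hyu : IsUnit y := IsUnit.of_mul_eq_one _ hyy
  set Q := (x ^ 2 * y - a * (y + y ^ 2 + x ^ 2)) * (y ^ 2 - a * (x ^ 2 + x ^ 2 * y + y)) *
    (y - b) * (x ^ 2 - b * y) * (x * y - t * (x ^ 2 * y + y + y ^ 2 + x ^ 2)) with hQ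
  have hQA : Q ∈ 𝔸 := by
    refine mul_mem (mul_mem (mul_mem (mul_mem ?_ ?_) ?_) ?_) ?_
    all_goals apply_rules [mul_mem, sub_mem, add_mem, pow_mem]
  have hQF : Q * F = x * y ^ 2 * ((x ^ 2 - 1) * (y ^ 2 - x ^ 2) * (y - 1) * (x ^ 2 - y)) := by
    rw [hQ, ← g₁, ← g₂, ← g₃, ← g₄, ← g₅, ← g₆, ← hF]
    ring
  refine ⟨x * y * Q, mul_mem (mul_mem hx hy) hQA, ?_, ?_⟩
  · rw [hQ, ← g₁, ← g₂, ← g₃, ← g₄, ← g₅]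
    exact (hxu.mul hyu).mul (((((((hxu.pow 2).mul hyu).mul h₁).mul ((hyu.pow 2).mul h₂)).mul
      (hyu.mul h₃)).mul ((hxu.pow 2).mul h₄)).mul ((hxu.mul hyu).mul h₅))
  · have h : x * y * Q * (x' * y' * (v + w * F)) =
        Q * v + w * (x * y ^ 2 * ((x ^ 2 - 1) * (y ^ 2 - x ^ 2) * (y - 1) * (x ^ 2 - y))) := by
      rw [← hQF]
      linear_combination (Q * (v + w * F)) * (y * y' * hxx + hyy)
    rw [h]
    have := one_mem 𝔸
    apply_rules [add_mem, mul_mem, sub_mem, pow_mem]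

lemma isRationalSeries_ansatz [Algebra R (BiLaurent k)] {a b : R} {α β : k⟦X⟧} {Ω : BiLaurent k}
    (ha : algebraMap R (BiLaurent k) a = algebraMap k⟦X⟧ _ α)
    (hb : algebraMap R (BiLaurent k) b = algebraMap k⟦X⟧ _ β)
    (hα : constantCoeff α = 0) (hβ : constantCoeff β = 0)
    (hΩ : den₁ α * den₂ α * den₃ β * den₄ β * Ω = ansatzNum k) (V W : Polynomial R) :
    IsRationalSeries R (mon k 1 0) (mon k 0 1)
      (PowerSeries.C (mon k (-1) (-1)) * ((V.map (algebraMap R (BiLaurent k)) : (BiLaurent k)⟦X⟧) +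
        (W.map (algebraMap R (BiLaurent k)) : (BiLaurent k)⟦X⟧) *
          mk fun n => stepSum k ^ n * Ω)) := by
  have hT : (1 - X * PowerSeries.C (stepSum k)) * (mk fun n => stepSum k ^ n * Ω) =
      PowerSeries.C Ω := by
    ext1 n
    rw [sub_mul, one_mul, map_sub, mul_assoc]
    cases n with
    | zero => simp
    | succ n =>
      rw [coeff_succ_X_mul, coeff_C_mul, coeff_C, if_neg n.succ_ne_zero]
      simp only [coeff_mk]
      ring
  generalize (mk fun n => stepSum k ^ n * Ω) = T at hT ⊢
  have e₁ : mon k (-2) 0 = mon k (-1) 0 ^ 2 := by rw [sq, mon_mul_mon]; norm_num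
  have e₂ : mon k 2 (-2) = mon k 1 0 ^ 2 * mon k 0 (-1) ^ 2 := by
    simp only [sq, mon_mul_mon]; norm_num
  have e₃ : mon k (-2) 1 = mon k (-1) 0 ^ 2 * mon k 0 1 := by simp only [sq, mon_mul_mon]; norm_num
  have e₄ : mon k 2 (-1) = mon k 1 0 ^ 2 * mon k 0 (-1) := by simp only [sq, mon_mul_mon]; norm_num
  have e₅ : mon k (-1) 1 = mon k (-1) 0 * mon k 0 1 := by rw [mon_mul_mon]; norm_num
  have e₆ : mon k 1 (-1) = mon k 1 0 * mon k 0 (-1) := by rw [mon_mul_mon]; norm_num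
  have e₇ : mon k (-1) (-1) = mon k (-1) 0 * mon k 0 (-1) := by rw [mon_mul_mon]; norm_num
  have hd {γ : k⟦X⟧} (hγ : constantCoeff γ = 0) (F : BiLaurent k) :
      IsUnit (PowerSeries.C (1 - algebraMap k⟦X⟧ (BiLaurent k) γ * F)) :=
    (isUnit_one_sub_algebraMap_mul hγ F).map PowerSeries.C
  have hS : IsUnit (1 - X * PowerSeries.C (stepSum k)) := by
    rw [isUnit_iff_constantCoeff]
    simp
  have h₁ := hd hα (mon k (-2) 0 + mon k (-2) 1 + mon k 0 (-1))
  have h₂ := hd hα (mon k 2 (-2) + mon k 2 (-1) + mon k 0 (-1))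
  have h₃ := hd hβ (mon k 0 (-1))
  have h₄ := hd hβ (mon k (-2) 1)
  have hF := congr_arg PowerSeries.C hΩ
  rw [den₁, den₂, den₃, den₄, ansatzNum, map_mul, ← hT, ← mul_assoc] at hF
  simp only [stepSum, e₁, e₂, e₃, e₄, e₅, e₆, map_sub, map_mul, map_one, map_add, map_pow]
    at h₁ h₂ h₃ h₄ hS hF
  have hx : PowerSeries.C (mon k 1 0) * PowerSeries.C (mon k (-1) 0) = 1 := by
    rw [← map_mul, mon_mul_mon]
    simp [mon_zero]
  have hy : PowerSeries.C (mon k 0 1) * PowerSeries.C (mon k 0 (-1)) = 1 := by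
    rw [← map_mul, mon_mul_mon]
    simp [mon_zero]
  have hA : PowerSeries.C (algebraMap k⟦X⟧ _ α) ∈ Algebra.adjoin R {(X : (BiLaurent k)⟦X⟧),
      PowerSeries.C (mon k 1 0), PowerSeries.C (mon k 0 1)} := by
    rw [← ha, ← PowerSeries.algebraMap_apply]
    exact algebraMap_mem _ a
  have hB : PowerSeries.C (algebraMap k⟦X⟧ _ β) ∈ Algebra.adjoin R {(X : (BiLaurent k)⟦X⟧),
      PowerSeries.C (mon k 1 0), PowerSeries.C (mon k 0 1)} := by
    rw [← hb, ← PowerSeries.algebraMap_apply]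
    exact algebraMap_mem _ b
  rw [e₇, map_mul]
  exact exists_isUnit_mul_mem (Algebra.subset_adjoin (by simp))
    (Algebra.subset_adjoin (by simp)) hA hB (Algebra.subset_adjoin (by simp))
    (coe_map_mem_adjoin _ _ V) (coe_map_mem_adjoin _ _ W) hx hy h₁ h₂ h₃ h₄ hS hF

/-- Polynomial combinations of `1` and the Bethe ansatz series satisfy a linear differential
equation. -/
theorem exists_ode_ansatz [IsDomain R] [CharZero R] {ρ : R →+* k⟦X⟧} {a b : R} {Ω : BiLaurent k}
    (ha : constantCoeff (ρ a) = 0) (hb : constantCoeff (ρ b) = 0)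
    (hΩ : den₁ (ρ a) * den₂ (ρ a) * den₃ (ρ b) * den₄ (ρ b) * Ω = ansatzNum k)
    (V W : Polynomial R) :
    ∃ (m : ℕ) (p : Fin (m + 1) → Polynomial R), (∃ i, p i ≠ 0) ∧
      ∑ i : Fin (m + 1), ((p i).map ρ : k⟦X⟧⟦X⟧) * (derivative k⟦X⟧)^[i]
        ((V.map ρ : k⟦X⟧⟦X⟧) + (W.map ρ : k⟦X⟧⟦X⟧) * ansatzSeries Ω (0, 0)) = 0 := by
  let : Algebra R k⟦X⟧ := ρ.toAlgebra
  let : Algebra R (BiLaurent k) := ((algebraMap k⟦X⟧ (BiLaurent k)).comp ρ).toAlgebra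
  have : IsScalarTower R k⟦X⟧ (BiLaurent k) := IsScalarTower.of_algebraMap_eq fun _ => rfl
  have h := exists_ode_residue (R := R) (C' := k⟦X⟧)
    (Dx := (monDerivation (k := k) (linearWeight 1 0) (-1) 0).restrictScalars R)
    (Dy := (monDerivation (k := k) (linearWeight 0 1) 0 (-1)).restrictScalars R)
    (res := fun i j => (monCoeff (k := k) (i, j)).restrictScalars R)
    (x := mon k 1 0) (y := mon k 0 1)
    (by simp [monDerivation_mon, linearWeight_apply, mon_zero])
    (by simp [monDerivation_mon, linearWeight_apply])
    (by simp [monDerivation_mon, linearWeight_apply])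
    (by simp [monDerivation_mon, linearWeight_apply, mon_zero])
    (fun i j f => by simp [monCoeff_monDerivation, linearWeight_apply])
    (fun i j f => by simp [monCoeff_monDerivation, linearWeight_apply])
    (isRationalSeries_ansatz (a := a) (b := b) rfl rfl ha hb hΩ V W)
  suffices hres : coeffwise ((monCoeff (k := k) (-1, -1)).restrictScalars R)
      (PowerSeries.C (mon k (-1) (-1)) * ((V.map (algebraMap R (BiLaurent k)) : (BiLaurent k)⟦X⟧) +
        (W.map (algebraMap R (BiLaurent k)) : (BiLaurent k)⟦X⟧) *
          mk fun n => stepSum k ^ n * Ω)) =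
      (V.map ρ : k⟦X⟧⟦X⟧) + (W.map ρ : k⟦X⟧⟦X⟧) * ansatzSeries Ω (0, 0) by
    rw [hres] at h
    exact h
  ext1 n
  simp only [coeff_coeffwise, coeff_C_mul, LinearMap.coe_restrictScalars, monCoeff_mon_mul,
    sub_self]
  rw [map_add, map_add, map_add]
  simp only [coeff_mul, map_sum, Polynomial.coeff_coe, Polynomial.coeff_map, coeff_mk,
    coeff_ansatzSeries, Nat.cast_zero]
  have h₁ (r : R) (F : BiLaurent k) : monCoeff (0, 0) (algebraMap R (BiLaurent k) r * F) =
      ρ r * monCoeff (0, 0) F := by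
    have := (monCoeff (k := k) (0, 0)).map_smul (ρ r) F
    rwa [Algebra.smul_def, smul_eq_mul] at this
  congr 1
  · have := h₁ (V.coeff n) 1
    rw [monCoeff_one, mul_one, mul_one] at this
    exact this
  · exact Finset.sum_congr rfl fun e _ => h₁ _ _

lemma map_iterate_derivative (ρ : R →+* k) (F : R⟦X⟧) (n : ℕ) :
    PowerSeries.map ρ ((derivative R)^[n] F) = (derivative k)^[n] (PowerSeries.map ρ F) := by
  induction n with
  | zero => rfl
  | succ n ih =>
    rw [Function.iterate_succ_apply', Function.iterate_succ_apply', ← ih]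
    ext m
    simp [coeff_derivative]

lemma isDFinite_of_map {ρ : R →+* k} (hρ : Function.Injective ρ) {F : R⟦X⟧}
    (h : ∃ (m : ℕ) (p : Fin (m + 1) → Polynomial R), (∃ i, p i ≠ 0) ∧
      ∑ i : Fin (m + 1), ((p i).map ρ : k⟦X⟧) * (derivative k)^[i] (PowerSeries.map ρ F) = 0) :
    IsDFinite F := by
  obtain ⟨m, p, hp, h⟩ := h
  refine ⟨m, p, hp, PowerSeries.map_injective ρ hρ ?_⟩
  rw [map_zero, ← h, map_sum]
  refine Finset.sum_congr rfl fun i _ => ?_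
  rw [map_mul, ← map_iterate_derivative, Polynomial.polynomial_map_coe]
  rfl

end AnsatzEquation

section Denominators

variable {R : Type*} [CommRing R] {D W : R⟦X⟧}

lemma exists_eq_mul_C_add_X_mul [IsDomain R] [DecompositionMonoid R] (hD : constantCoeff D ≠ 0)
    (h : IsRelPrime (constantCoeff D) (constantCoeff W)) {V : R⟦X⟧} (hV : D ∣ V * W) :
    ∃ f V', V = D * PowerSeries.C f + X * V' ∧ D ∣ V' * W := by
  have h₁ := map_dvd (constantCoeff (R := R)) hV
  rw [map_mul] at h₁
  obtain ⟨f, hf⟩ := h.dvd_of_dvd_mul_right h₁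
  obtain ⟨V', hV'⟩ : X ∣ V - D * PowerSeries.C f := by
    rw [X_dvd_iff, map_sub, map_mul, constantCoeff_C, hf, sub_self]
  refine ⟨f, V', by rw [← hV']; ring, ?_⟩
  obtain ⟨Z, hZ⟩ : D ∣ X * (V' * W) := by
    rw [← mul_assoc, ← hV', sub_mul]
    exact dvd_sub hV ⟨PowerSeries.C f * W, by ring⟩
  obtain ⟨Z', rfl⟩ : X ∣ Z := (X_prime.dvd_or_dvd ⟨_, hZ.symm⟩).resolve_left
    fun h => hD (X_dvd_iff.1 h)
  exact ⟨Z', mul_left_cancel₀ X_ne_zero (by rw [hZ]; ring)⟩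

/-- Power series over a domain with relatively prime constant coefficients satisfy Euclid's
lemma. -/
theorem dvd_of_dvd_mul_of_isRelPrime_constantCoeff [IsDomain R] [DecompositionMonoid R]
    (hD : constantCoeff D ≠ 0) (h : IsRelPrime (constantCoeff D) (constantCoeff W)) {V : R⟦X⟧}
    (hV : D ∣ V * W) : D ∣ V := by
  choose! f V' hf hV' using fun V : R⟦X⟧ => exists_eq_mul_C_add_X_mul hD h (V := V)
  have hs (n : ℕ) : D ∣ V'^[n] V * W := by
    induction n with
    | zero => exact hV
    | succ n ih => rw [Function.iterate_succ_apply']; exact hV' _ ih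
  have hE (n m : ℕ) : coeff n (V'^[m] V - D * mk fun i => f (V'^[m + i] V)) = 0 := by
    have h₁ (m : ℕ) : (V'^[m] V - D * mk fun i => f (V'^[m + i] V)) =
        X * (V'^[m + 1] V - D * mk fun i => f (V'^[m + 1 + i] V)) := by
      have h₂ := eq_X_mul_shift_add_const (mk fun i => f (V'^[m + i] V))
      rw [← coeff_zero_eq_constantCoeff_apply] at h₂
      simp only [coeff_mk, add_zero, ← add_assoc] at h₂
      rw [h₂]
      conv_lhs => enter [1]; rw [hf _ (hs m)]
      rw [← Function.iterate_succ_apply' V' m V]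
      simp only [add_right_comm m _ 1]
      ring
    induction n generalizing m with
    | zero => rw [h₁]; simp
    | succ n ih => rw [h₁, coeff_succ_X_mul, ih]
  exact ⟨_, sub_eq_zero.1 (PowerSeries.ext fun n => by simpa using hE n 0)⟩

/-- The numerators of the iterated derivatives of the inverse of `D`. -/
noncomputable def invDerivNum (D : R⟦X⟧) : ℕ → R⟦X⟧
  | 0 => 1
  | j + 1 => D * derivative R (invDerivNum D j) - (j + 1) * derivative R D * invDerivNum D j

lemma dvd_invDerivNum_sub (D : R⟦X⟧) (j : ℕ) :
    D ∣ invDerivNum D j - (-1) ^ j * (j.factorial : R⟦X⟧) * derivative R D ^ j := by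
  induction j with
  | zero => simp [invDerivNum]
  | succ j ih =>
    obtain ⟨E, hE⟩ := ih
    refine ⟨derivative R (invDerivNum D j) - (j + 1) * derivative R D * E, ?_⟩
    rw [invDerivNum, Nat.factorial_succ]
    push_cast
    linear_combination (-(j + 1) * derivative R D) * hE

variable {L : Type*} [CommRing L] {ρ : R →+* L} {B : L⟦X⟧}

lemma map_derivative (ρ : R →+* L) (F : R⟦X⟧) :
    derivative L (PowerSeries.map ρ F) = PowerSeries.map ρ (derivative R F) :=
  (map_iterate_derivative ρ F 1).symm

lemma pow_mul_iterate_derivative_inv (hB : PowerSeries.map ρ D * B = 1) (j : ℕ) :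
    PowerSeries.map ρ D ^ (j + 1) * (derivative L)^[j] B =
      PowerSeries.map ρ (invDerivNum D j) := by
  induction j with
  | zero => simpa [invDerivNum] using hB
  | succ j ih =>
    have h := congr_arg (derivative L) ih
    rw [Derivation.leibniz, Derivation.leibniz_pow, map_derivative, map_derivative] at h
    simp only [add_tsub_cancel_right, smul_eq_mul, nsmul_eq_mul] at h
    rw [Function.iterate_succ_apply', invDerivNum]
    simp only [map_sub, map_mul, map_add, map_natCast, map_one]
    push_cast at h
    linear_combination PowerSeries.map ρ D * h -
      (j + 1) * PowerSeries.map ρ (derivative R D) * ih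

/-- If the inverse of `D` satisfies a linear differential equation, then `D` divides a nonzero
polynomial. -/
theorem exists_dvd_coe_of_ode [IsDomain R] [CharZero R] [DecompositionMonoid R]
    (hρ : Function.Injective ρ) (hB : PowerSeries.map ρ D * B = 1) (hD : constantCoeff D ≠ 0)
    {u : R⟦X⟧} (hu : derivative R D = X * u) (h : IsRelPrime (constantCoeff D) (constantCoeff u))
    {m : ℕ} {p : Fin (m + 1) → Polynomial R} (hp : ∃ i, p i ≠ 0)
    (hode : ∑ i : Fin (m + 1), ((p i).map ρ : L⟦X⟧) * (derivative L)^[i] B = 0) :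
    ∃ V : Polynomial R, V ≠ 0 ∧ D ∣ (V : R⟦X⟧) := by
  classical
  obtain ⟨s, hs, hmax⟩ : ∃ s, p s ≠ 0 ∧ ∀ i, p i ≠ 0 → i ≤ s := by
    obtain ⟨i, hi⟩ := hp
    obtain ⟨s, hs, hmax⟩ := Finset.exists_max_image (Finset.univ.filter fun i => p i ≠ 0) id
      ⟨i, by simpa using hi⟩
    exact ⟨s, by simpa using hs, fun i hi => hmax i (by simpa using hi)⟩
  have hsum : ∑ i : Fin (m + 1), (p i : R⟦X⟧) * D ^ ((s : ℕ) - i) * invDerivNum D i = 0 := by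
    apply PowerSeries.map_injective ρ hρ
    rw [map_zero, map_sum, ← mul_zero (PowerSeries.map ρ D ^ ((s : ℕ) + 1)), ← hode,
      Finset.mul_sum]
    refine Finset.sum_congr rfl fun i _ => ?_
    by_cases hi : p i = 0
    · simp [hi]
    · have his : (s : ℕ) + 1 = ((s : ℕ) - i) + (i + 1) := by
        have := Fin.le_def.1 (hmax i hi)
        omega
      rw [his, pow_add, map_mul, map_mul, map_pow, ← pow_mul_iterate_derivative_inv hB,
        Polynomial.polynomial_map_coe]
      ring
  have hdvd : D ∣ (p s : R⟦X⟧) * invDerivNum D s := by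
    rw [← Finset.add_sum_erase _ _ (Finset.mem_univ s)] at hsum
    rw [Nat.sub_self, pow_zero, mul_one] at hsum
    rw [eq_neg_of_add_eq_zero_left hsum, dvd_neg]
    refine Finset.dvd_sum fun i hi => ?_
    by_cases hpi : p i = 0
    · simp [hpi]
    · have his : (s : ℕ) - i ≠ 0 := by
        have := lt_of_le_of_ne (hmax i hpi) (Finset.ne_of_mem_erase hi)
        rw [Fin.lt_def] at this
        omega
      exact Dvd.dvd.mul_right (Dvd.dvd.mul_left (dvd_pow_self D his) _) _
  refine ⟨Polynomial.C ((-1) ^ (s : ℕ) * ((s : ℕ).factorial : R)) * Polynomial.X ^ (s : ℕ) * p s,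
    mul_ne_zero (mul_ne_zero ?_ (pow_ne_zero _ Polynomial.X_ne_zero)) hs,
    dvd_of_dvd_mul_of_isRelPrime_constantCoeff (W := u ^ (s : ℕ)) hD ?_ ?_⟩
  · rw [Ne, Polynomial.C_eq_zero]
    exact mul_ne_zero (pow_ne_zero _ (neg_ne_zero.2 one_ne_zero))
      (Nat.cast_ne_zero.2 (Nat.factorial_ne_zero _))
  · rw [map_pow]
    exact h.pow_right
  · have h₁ := dvd_sub hdvd ((dvd_invDerivNum_sub D s).mul_left (p s : R⟦X⟧))
    convert h₁ using 1
    rw [hu]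
    push_cast
    simp only [map_mul, map_pow, map_neg, map_one, map_natCast]
    ring

end Denominators

section Specializations

variable {R k : Type*} [CommRing R] [CommRing k] [IsDomain k] [CharZero k]

lemma constantCoeff_loopGF (a b : R) : constantCoeff (loopGF model22 a b) = 1 := by
  rw [← coeff_zero_eq_constantCoeff_apply, coeff_loopGF, walkSum, if_pos rfl]

lemma exists_derivative_loopGF (a b : R) : ∃ g, derivative R (loopGF model22 a b) = X * g ∧
    constantCoeff g = 2 * a ^ 2 * b := by
  obtain ⟨g, hg⟩ : X ∣ derivative R (loopGF model22 a b) := by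
    rw [X_dvd_iff, ← coeff_zero_eq_constantCoeff_apply, coeff_derivative, coeff_loopGF, walkSum,
      sum_neighbours_zero]
    simp [walkSum]
  refine ⟨g, hg, ?_⟩
  have h := congr_arg (coeff 1) hg
  rw [← zero_add 1, coeff_succ_X_mul, coeff_zero_eq_constantCoeff_apply, coeff_derivative,
    coeff_loopGF] at h
  have h₁ := sum_neighbours_horizontal (f := fun u => visitWeight a b u * walkSum a b 0 u) 0
  rw [← h, walkSum, sum_neighbours_zero, walkSum, h₁]
  simp only [walkSum, visitWeight]
  norm_num
  ring

variable [IsDomain R] [CharZero R]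

/-- The generating function of loops is a ratio of polynomial combinations of `1` and a series
`B`, all of which satisfy a linear differential equation. -/
theorem exists_loopGF_eq (ρ : R →+* k⟦X⟧) {a b : R} (ha : constantCoeff (ρ a) = 1)
    (hb : constantCoeff (ρ b) = 1) :
    ∃ B : k⟦X⟧⟦X⟧,
      (1 + PowerSeries.C (ρ ((a - 1) * (b - 1))) * B) * PowerSeries.map ρ (loopGF model22 a b) =
        B ∧
      ∀ V W : Polynomial R, ∃ (m : ℕ) (p : Fin (m + 1) → Polynomial R), (∃ i, p i ≠ 0) ∧
        ∑ i : Fin (m + 1), ((p i).map ρ : k⟦X⟧⟦X⟧) * (derivative k⟦X⟧)^[i]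
          ((V.map ρ : k⟦X⟧⟦X⟧) + (W.map ρ : k⟦X⟧⟦X⟧) * B) = 0 := by
  have hα : constantCoeff (ρ (a - 1)) = 0 := by simp [ha]
  have hβ : constantCoeff (ρ (b - 1)) = 0 := by simp [hb]
  obtain ⟨Ω, hΩ⟩ : ∃ Ω : BiLaurent k, den₁ (ρ (a - 1)) * den₂ (ρ (a - 1)) * den₃ (ρ (b - 1)) *
      den₄ (ρ (b - 1)) * Ω = ansatzNum k :=
    ((((isUnit_one_sub_algebraMap_mul hα _).mul (isUnit_one_sub_algebraMap_mul hα _)).mul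
      (isUnit_one_sub_algebraMap_mul hβ _)).mul (isUnit_one_sub_algebraMap_mul hβ _)).dvd.imp
      fun _ => Eq.symm
  refine ⟨PowerSeries.C (ρ a) * ansatzSeries Ω (0, 0), ?_, fun V W => ?_⟩
  · have h := loopGF_of_ansatz hα hβ hΩ
    rwa [← map_one ρ, ← map_add, ← map_add, ← map_mul, add_sub_cancel, add_sub_cancel,
      ← map_loopGF] at h
  · have h := exists_ode_ansatz hα hβ hΩ V (W * Polynomial.C a)
    simpa only [Polynomial.map_mul, Polynomial.map_C, Polynomial.coe_mul, Polynomial.coe_C,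
      mul_assoc] using h

/-- If one of the boundaries is not interacting, the generating function of loops is D-finite. -/
theorem isDFinite_loopGF {ρ : R →+* k⟦X⟧} (hρ : Function.Injective ρ) {a b : R}
    (ha : constantCoeff (ρ a) = 1) (hb : constantCoeff (ρ b) = 1)
    (hab : (a - 1) * (b - 1) = 0) : IsDFinite (loopGF model22 a b) := by
  obtain ⟨B, hB, hode⟩ := exists_loopGF_eq ρ ha hb
  rw [hab, map_zero, map_zero, zero_mul, add_zero, one_mul] at hB
  refine isDFinite_of_map hρ ?_
  simpa [hB] using hode 0 1

/-- Under a coprimality condition, the generating function of loops is a ratio of D-finite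
series. -/
theorem exists_isDFinite_mul_loopGF [DecompositionMonoid R] {ρ : R →+* k⟦X⟧}
    (hρ : Function.Injective ρ) {a b : R}
    (ha : constantCoeff (ρ a) = 1) (hb : constantCoeff (ρ b) = 1) (hab : a + b - a * b ≠ 0)
    (h : IsRelPrime (a + b - a * b) (2 * a ^ 2 * b)) :
    ∃ F H : R⟦X⟧, IsDFinite F ∧ IsDFinite H ∧ H ≠ 0 ∧ H * loopGF model22 a b = F := by
  obtain ⟨B, hB, hode⟩ := exists_loopGF_eq ρ ha hb
  obtain ⟨g, hg, hg₀⟩ := exists_derivative_loopGF a b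
  have hG₀ := constantCoeff_loopGF a b
  generalize loopGF model22 a b = G at *
  set γ := (a - 1) * (b - 1) with hγ
  obtain ⟨J, hJ⟩ : ∃ J, G * J = 1 := ⟨_, mul_invOfUnit G 1 (by simpa using hG₀)⟩
  have hJ₀ : constantCoeff J = 1 := by
    simpa [hG₀] using congr_arg constantCoeff hJ
  have hJ' : derivative R J = X * (-J ^ 2 * g) := by
    have h₁ := congr_arg (derivative R) hJ
    rw [Derivation.leibniz, hg] at h₁
    simp only [smul_eq_mul, Derivation.map_one_eq_zero] at h₁
    linear_combination J * h₁ - derivative R J * hJ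
  have hφJ : PowerSeries.map ρ G * PowerSeries.map ρ J = 1 := by rw [← map_mul, hJ, map_one]
  have hD₀ : constantCoeff (J - PowerSeries.C γ) = a + b - a * b := by
    rw [map_sub, hJ₀, constantCoeff_C, hγ]
    ring
  have hDB : PowerSeries.map ρ (J - PowerSeries.C γ) * B = 1 := by
    rw [map_sub, PowerSeries.map_C]
    linear_combination (1 + PowerSeries.C (ρ γ) * B) * hφJ - PowerSeries.map ρ J * hB
  obtain ⟨m, p, hp, hode₁⟩ := hode 0 1
  simp only [Polynomial.map_zero, Polynomial.coe_zero, Polynomial.map_one, Polynomial.coe_one,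
    one_mul, zero_add] at hode₁
  obtain ⟨V, hV, F, hF⟩ := exists_dvd_coe_of_ode hρ hDB (hD₀ ▸ hab) (u := -J ^ 2 * g)
    (by rw [map_sub, derivative_C, sub_zero, hJ'])
    (by simpa [hD₀, hg₀, hJ₀, IsRelPrime.neg_right_iff] using h) hp hode₁
  have hφF : PowerSeries.map ρ F = (V.map ρ : k⟦X⟧⟦X⟧) * B := by
    rw [Polynomial.polynomial_map_coe, hF, map_mul]
    linear_combination -PowerSeries.map ρ F * hDB
  have hmul : (V + PowerSeries.C γ * F) * G = F := by
    rw [hF]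
    linear_combination F * hJ
  refine ⟨F, V + PowerSeries.C γ * F, isDFinite_of_map hρ ?_, isDFinite_of_map hρ ?_, ?_, hmul⟩
  · simpa [hφF] using hode 0 V
  · simpa [hφF, Polynomial.polynomial_map_coe, mul_assoc] using hode V (Polynomial.C γ * V)
  · intro h₀
    rw [h₀, zero_mul] at hmul
    rw [← hmul, mul_zero] at hF
    exact hV (Polynomial.coe_eq_zero_iff.1 hF)

end Specializations

/-- The embedding of `ℚ[a]` into `ℚ⟦α⟧` with `a = 1 + α`. -/
noncomputable def shiftToSeries : Polynomial ℚ →+* ℚ⟦X⟧ :=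
  Polynomial.coeToPowerSeries.ringHom.comp (Polynomial.taylorAlgHom (1 : ℚ)).toRingHom

lemma shiftToSeries_injective : Function.Injective shiftToSeries :=
  (Polynomial.coe_injective ℚ).comp (Polynomial.taylor_injective 1)

lemma constantCoeff_shiftToSeries_X : constantCoeff (shiftToSeries Polynomial.X) = 1 := by
  simp [shiftToSeries]

/-- The embedding of `ℚ[a, b]` into a power series ring with `a = 1 + X * C a` and
`b = 1 + X * C b`. -/
noncomputable def scaleShift :
    MvPolynomial (Fin 2) ℚ →+* Polynomial (MvPolynomial (Fin 2) ℚ) :=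
  MvPolynomial.eval₂Hom (algebraMap ℚ _)
    fun i => 1 + Polynomial.X * Polynomial.C (MvPolynomial.X i)

lemma scaleShift_injective : Function.Injective scaleShift := by
  have h : ((MvPolynomial.eval₂Hom MvPolynomial.C fun i => MvPolynomial.X i - 1).comp
      ((Polynomial.evalRingHom 1).comp scaleShift)) = RingHom.id (MvPolynomial (Fin 2) ℚ) :=
    MvPolynomial.ringHom_ext (fun r => by simp [scaleShift, Polynomial.algebraMap_apply])
      fun i => by simp [scaleShift]
  exact Function.Injective.of_comp (f := (MvPolynomial.eval₂Hom MvPolynomial.C fun i =>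
    MvPolynomial.X i - 1).comp (Polynomial.evalRingHom 1)) (by
      rw [← RingHom.coe_comp, RingHom.comp_assoc, h]; exact Function.injective_id)

lemma not_X_dvd_X_add_X_sub (i : Fin 2) : ¬ (MvPolynomial.X i : MvPolynomial (Fin 2) ℚ) ∣
    MvPolynomial.X 0 + MvPolynomial.X 1 - MvPolynomial.X 0 * MvPolynomial.X 1 := by
  intro h
  have := map_dvd (MvPolynomial.eval fun j => if j = i then (0 : ℚ) else 1) h
  fin_cases i <;> simp at this

lemma isRelPrime_X_add_X_sub : IsRelPrime
    (MvPolynomial.X 0 + MvPolynomial.X 1 - MvPolynomial.X 0 * MvPolynomial.X 1 :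
      MvPolynomial (Fin 2) ℚ) (2 * MvPolynomial.X 0 ^ 2 * MvPolynomial.X 1) := by
  have hX (i : Fin 2) : IsRelPrime (MvPolynomial.X 0 + MvPolynomial.X 1 -
      MvPolynomial.X 0 * MvPolynomial.X 1 : MvPolynomial (Fin 2) ℚ) (MvPolynomial.X i) :=
    ((MvPolynomial.X_prime (i := i)).irreducible.isRelPrime_iff_not_dvd.2
      (not_X_dvd_X_add_X_sub i)).symm
  have h₂ : IsUnit (2 : MvPolynomial (Fin 2) ℚ) := by
    rw [← map_ofNat (algebraMap ℚ (MvPolynomial (Fin 2) ℚ)) 2]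
    exact (isUnit_iff_ne_zero.2 two_ne_zero).map _
  exact ((h₂.isRelPrime_right).mul_right (hX 0).pow_right).mul_right (hX 1)

/-- Model 22: `G(t;a,1)` and `G(t;1,b)` are D-finite, and `G(t;a,b)` is a ratio of D-finite series. -/
theorem model22_dfinite_and_ratio :
    IsDFinite (loopGF ({((1:ℤ), (0:ℤ)), (-1, 0), (-1, 1), (1, -1)} : Set (ℤ × ℤ)) (Polynomial.X : Polynomial ℚ) 1) ∧
    IsDFinite (loopGF ({((1:ℤ), (0:ℤ)), (-1, 0), (-1, 1), (1, -1)} : Set (ℤ × ℤ)) (1 : Polynomial ℚ) Polynomial.X) ∧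
    ∃ F H : PowerSeries (MvPolynomial (Fin 2) ℚ),
      IsDFinite F ∧ IsDFinite H ∧ H ≠ 0 ∧
      H * loopGF ({((1:ℤ), (0:ℤ)), (-1, 0), (-1, 1), (1, -1)} : Set (ℤ × ℤ))
        (MvPolynomial.X (0 : Fin 2)) (MvPolynomial.X (1 : Fin 2)) = F := by
  refine ⟨isDFinite_loopGF shiftToSeries_injective constantCoeff_shiftToSeries_X
      (by rw [map_one, map_one]) (by ring),
    isDFinite_loopGF shiftToSeries_injective (by rw [map_one, map_one])
      constantCoeff_shiftToSeries_X (by ring),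
    exists_isDFinite_mul_loopGF (ρ := Polynomial.coeToPowerSeries.ringHom.comp scaleShift)
      ((Polynomial.coe_injective _).comp scaleShift_injective) ?_ ?_ ?_ isRelPrime_X_add_X_sub⟩
  · simp [scaleShift]
  · simp [scaleShift]
  · intro h
    exact not_X_dvd_X_add_X_sub 0 (h ▸ dvd_zero _)
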